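/- arXiv:2211.16468 — 8 statements merged into one kernel-verified Lean document; each statement's English description precedes it below -/
import Mathlib

section
/- Let G be a DAG and let A, B, C be pairwise disjoint sets of vertices. Then there exists a path from a vertex of A to a vertex of B that is open given C if and only if there exists a way from a vertex of A to a vertex of B that is open given C. -/
/-- A directed graph on vertex type `V`, given by its edge relation. -/
structure CausalGraph (V : Type) where
  Edge : V → V → Prop

namespace CausalGraph

variable {V : Type}

/-- `G.Desc u v`: `v` is a descendant of `u`, i.e. `v` is reachable from `u`
along directed edges (every vertex is a descendant of itself). -/
def Desc (G : CausalGraph V) (u v : V) : Prop := Relation.ReflTransGen G.Edge u v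

/-- The set of descendants of a set of vertices. -/
def descendants (G : CausalGraph V) (A : Set V) : Set V := {v | ∃ a ∈ A, G.Desc a v}

/-- The set of ancestors of a set of vertices. -/
def ancestors (G : CausalGraph V) (A : Set V) : Set V := {u | ∃ a ∈ A, G.Desc u a}

/-- A graph is acyclic (a DAG) if it has no directed cycle. -/
def Acyclic (G : CausalGraph V) : Prop := ∀ v : V, ¬ Relation.TransGen G.Edge v v

/-- `G.underline S` : the graph `G` with every edge whose tail lies in `S` removed. -/
def underline (G : CausalGraph V) (S : Set V) : CausalGraph V :=
  ⟨fun u v => G.Edge u v ∧ u ∉ S⟩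

/-- A walk in `G`: a sequence of `len + 1` vertices, where consecutive vertices are
joined by an edge of `G` in either direction; `dir i = true` means the `i`-th edge is
traversed forwards (`vert i → vert (i+1)`), `dir i = false` means it is traversed
backwards (`vert i ← vert (i+1)`). -/
structure Walk (G : CausalGraph V) where
  len : ℕ
  vert : Fin (len + 1) → V
  dir : Fin len → Bool
  valid : ∀ i : Fin len,
    if dir i then G.Edge (vert i.castSucc) (vert i.succ)
    else G.Edge (vert i.succ) (vert i.castSucc)

namespace Walk

variable {G : CausalGraph V}

/-- The first vertex of a walk. -/
def first (w : G.Walk) : V := w.vert 0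

/-- The last vertex of a walk. -/
def last (w : G.Walk) : V := w.vert (Fin.last w.len)

/-- A path is a walk with pairwise distinct vertices. -/
def IsPath (w : G.Walk) : Prop := Function.Injective w.vert

/-- A way is a walk in which each vertex occurs at most twice. -/
def IsWay (w : G.Walk) : Prop :=
  ∀ x : V, Set.ncard {j : Fin (w.len + 1) | w.vert j = x} ≤ 2

/-- A directed (causal) walk: every edge is traversed forwards. -/
def IsDirected (w : G.Walk) : Prop := ∀ i : Fin w.len, w.dir i = true

/-- A back-door walk: the first edge points into the first vertex. -/
def IsBD (w : G.Walk) : Prop := ∃ h : 0 < w.len, w.dir ⟨0, h⟩ = false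

/-- The occurrence at (interior) position `j` is a collider: both incident edges of the
walk point into `vert j`. -/
def ColliderAt (w : G.Walk) (j : Fin (w.len + 1)) : Prop :=
  ∃ (_ : 0 < (j : ℕ)) (h2 : (j : ℕ) < w.len),
    w.dir ⟨(j : ℕ) - 1, by omega⟩ = true ∧ w.dir ⟨(j : ℕ), h2⟩ = false

/-- The occurrence at (interior) position `j` is a non-collider. -/
def NonColliderAt (w : G.Walk) (j : Fin (w.len + 1)) : Prop :=
  ∃ (_ : 0 < (j : ℕ)) (h2 : (j : ℕ) < w.len),
    (w.dir ⟨(j : ℕ) - 1, by omega⟩ = false ∨ w.dir ⟨(j : ℕ), h2⟩ = true)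

/-- A path is open given `C` if every collider on it has a descendant in `C` and
every non-collider on it is not in `C`. -/
def PathOpen (w : G.Walk) (C : Set V) : Prop :=
  (∀ j, w.ColliderAt j → ∃ d ∈ C, G.Desc (w.vert j) d) ∧
  (∀ j, w.NonColliderAt j → w.vert j ∉ C)

/-- A way is open given `C` if every collider on it is in `C` and every non-collider
on it is not in `C`. -/
def WayOpen (w : G.Walk) (C : Set V) : Prop :=
  (∀ j, w.ColliderAt j → w.vert j ∈ C) ∧
  (∀ j, w.NonColliderAt j → w.vert j ∉ C)

/-- The `i`-th edge of the walk points out of the vertex `x` (i.e. `x` is its tail). -/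
def OutEdgeAt (w : G.Walk) (i : Fin w.len) (x : V) : Prop :=
  (w.dir i = true ∧ w.vert i.castSucc = x) ∨ (w.dir i = false ∧ w.vert i.succ = x)

end Walk

/-- d-separation: `G.dSep A B C` holds if no path from a vertex of `A` to a vertex of
`B` is open given `C`. -/
def dSep (G : CausalGraph V) (A B C : Set V) : Prop :=
  ¬ ∃ w : G.Walk, w.IsPath ∧ w.first ∈ A ∧ w.last ∈ B ∧ w.PathOpen C

/-- `Z` intercepts every directed path from a vertex of `X` to a vertex of `Y`. -/
def Intercepts (G : CausalGraph V) (X Y Z : Set V) : Prop :=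
  ∀ w : G.Walk, w.IsPath → w.IsDirected → w.first ∈ X → w.last ∈ Y →
    ∃ j, w.vert j ∈ Z

/-- The front-door criterion: `X`, `Y`, `Z` are pairwise disjoint, FD(1) `Z` intercepts
all directed paths from `X` to `Y`, FD(2) `(Z ⊥ X)` in `G_underline(X)`, and FD(3)
`(Z ⊥ Y | X)` in `G_underline(Z)`. -/
def IsFDSet (G : CausalGraph V) (X Y Z : Set V) : Prop :=
  Disjoint X Y ∧ Disjoint X Z ∧ Disjoint Y Z ∧
  G.Intercepts X Y Z ∧
  (G.underline X).dSep Z X ∅ ∧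
  (G.underline Z).dSep Z Y X

/-- `Z_(i)`: the vertices `z ∈ R` with `({z} ⊥ X)` in `G_underline(X)`. -/
def Zi (G : CausalGraph V) (X R : Set V) : Set V :=
  {z ∈ R | (G.underline X).dSep {z} X ∅}

/-- `Z_(ii)`: the vertices `z ∈ Z_(i)` for which there is `S ⊆ Z_(i)` with
`({z} ∪ S ⊥ Y | X)` in `G_underline({z} ∪ S)`. -/
def Zii (G : CausalGraph V) (X Y R : Set V) : Set V :=
  {z ∈ G.Zi X R |
    ∃ S ⊆ G.Zi X R, (G.underline (insert z S)).dSep (insert z S) Y X}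

/-- `Z` is an `I`-inclusion minimal FD set relative to `(X, Y)` with `I ⊆ Z ⊆ R`:
no proper subset `Z' ⊊ Z` with `I ⊆ Z'` is an FD set relative to `(X, Y)`. -/
def IsMinFDSet (G : CausalGraph V) (X Y I R Z : Set V) : Prop :=
  I ⊆ Z ∧ Z ⊆ R ∧ G.IsFDSet X Y Z ∧
  ∀ Z' : Set V, Z' ⊂ Z → I ⊆ Z' → ¬ G.IsFDSet X Y Z'

end CausalGraph

namespace CausalGraph

variable {V : Type}

/-- One step of a walk, between states `(vertex, direction of the edge of arrival)`. The vertex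
being left satisfies `P` if it is a collider and lies outside `C` otherwise. -/
def Step (G : CausalGraph V) (P : V → Prop) (C : Set V) (x y : V × Bool) : Prop :=
  (if y.2 then G.Edge x.1 y.1 else G.Edge y.1 x.1) ∧
  (x.2 = true ∧ y.2 = false → P x.1) ∧ (x.2 = false ∨ y.2 = true → x.1 ∉ C)

/-- A chain of minimal length from `x` to `E` cannot be shortcut. -/
theorem exists_chain_without_shortcut {α : Type} {R : α → α → Prop} {E : α → Prop} {x y : α}
    (hy : E y) (hxy : Relation.ReflTransGen R x y) :
    ∃ (n : ℕ) (s : ℕ → α), s 0 = x ∧ E (s n) ∧ (∀ i < n, R (s i) (s (i + 1))) ∧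
      ∀ i j, i < j → j ≤ n → (E (s j) → E (s i)) → ¬ ∀ z, R (s j) z → R (s i) z := by
  classical
  have hex : ∃ (n : ℕ) (s : ℕ → α), s 0 = x ∧ E (s n) ∧ ∀ i < n, R (s i) (s (i + 1)) := by
    induction hxy using Relation.ReflTransGen.head_induction_on with
    | refl => exact ⟨0, fun _ => y, rfl, hy, by simp⟩
    | @head a c hac _ ih =>
      obtain ⟨n, s, h0, hn, hs⟩ := ih
      refine ⟨n + 1, fun k => Nat.casesOn k a s, rfl, hn, ?_⟩
      rintro (_ | i) hi
      · simpa [h0] using hac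
      · exact hs i (by omega)
  obtain ⟨s, h0, hn, hs⟩ := Nat.find_spec hex
  refine ⟨Nat.find hex, s, h0, hn, hs, fun i j hij hj hE hR => ?_⟩
  refine Nat.find_min hex (m := Nat.find hex - (j - i)) (by omega)
    ⟨fun k => if k ≤ i then s k else s (k + (j - i)), by simpa using h0, ?_, ?_⟩
  · rcases hj.eq_or_lt with hj' | hj'
    · rw [← hj'] at hn ⊢
      simpa [show j - (j - i) = i by omega] using hE hn
    · simpa [show ¬ Nat.find hex - (j - i) ≤ i by omega,
        show Nat.find hex - (j - i) + (j - i) = Nat.find hex by omega] using hn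
  · intro k hk
    rcases lt_trichotomy k i with h | h | h
    · simpa [h.le, Nat.succ_le_of_lt h] using hs k (by omega)
    · subst h
      simpa [show k + 1 + (j - k) = j + 1 by omega] using hR _ (hs j (by omega))
    · simpa [show ¬ k ≤ i by omega, show ¬ k + 1 ≤ i by omega,
        show k + 1 + (j - i) = k + (j - i) + 1 by omega] using hs (k + (j - i)) (by omega)

namespace Walk

variable {G : CausalGraph V}

/-- Colliders of the walk satisfy `P` and non-colliders lie outside `C`. -/
def OpenWith (w : G.Walk) (P : V → Prop) (C : Set V) : Prop :=
  (∀ j, w.ColliderAt j → P (w.vert j)) ∧ (∀ j, w.NonColliderAt j → w.vert j ∉ C)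

theorem OpenWith.reflTransGen_step {w : G.Walk} {P : V → Prop} {C : Set V}
    (hw : w.OpenWith P C) (h0 : w.first ∉ C) :
    ∃ d, Relation.ReflTransGen (G.Step P C) (w.first, false) (w.last, d) := by
  have key : ∀ k (hk : k < w.len + 1), Relation.ReflTransGen (G.Step P C) (w.first, false)
      (w.vert ⟨k, hk⟩, if h : 0 < k then w.dir ⟨k - 1, by omega⟩ else false) := by
    intro k
    induction k with
    | zero => intro hk; exact .refl
    | succ k ih =>
      intro hk
      refine (ih (by omega)).tail ⟨?_, ?_, ?_⟩
      · exact w.valid ⟨k, by omega⟩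
      · rintro ⟨h1, h2⟩
        by_cases h : 0 < k
        · exact hw.1 _ ⟨h, by simp; omega, by simpa [h] using h1, by simpa using h2⟩
        · simp [h] at h1
      · intro h1
        by_cases h : 0 < k
        · exact hw.2 _ ⟨h, by simp; omega, by simpa [h] using h1⟩
        · obtain rfl : k = 0 := by omega
          exact h0
  exact ⟨_, key w.len (by omega)⟩

/-- The walk read off from a sequence of states. -/
def ofStates {P : V → Prop} {C : Set V} (n : ℕ) (s : ℕ → V × Bool)
    (hs : ∀ i < n, G.Step P C (s i) (s (i + 1))) : G.Walk where
  len := n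
  vert i := (s i).1
  dir i := (s (i + 1)).2
  valid i := (hs i i.2).1

theorem openWith_ofStates {P : V → Prop} {C : Set V} (n : ℕ) (s : ℕ → V × Bool)
    (hs : ∀ i < n, G.Step P C (s i) (s (i + 1))) : (ofStates n s hs).OpenWith P C := by
  constructor
  · rintro j ⟨h1, h2, h3, h4⟩
    refine (hs j h2).2.1 ⟨?_, h4⟩
    simpa [ofStates, Nat.sub_add_cancel h1] using h3
  · rintro j ⟨h1, h2, h3⟩
    refine (hs j h2).2.2 ?_
    simpa [ofStates, Nat.sub_add_cancel h1] using h3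

end Walk

theorem reflTransGen_step_turn {G : CausalGraph V} {C : Set V} {v d : V} (hv : v ∉ C)
    (hd : d ∈ C) (hvd : G.Desc v d) :
    Relation.ReflTransGen (G.Step (· ∈ C) C) (v, true) (v, false) := by
  induction hvd using Relation.ReflTransGen.head_induction_on with
  | refl => exact absurd hd hv
  | @head u c huc _ ih =>
    have down : G.Step (· ∈ C) C (u, true) (c, true) := by simp [Step, huc, hv]
    by_cases hc : c ∈ C
    · exact (Relation.ReflTransGen.single down).tail (by simp [Step, huc, hc])
    · exact ((ih hc).head down).tail (by simp [Step, huc, hc])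

theorem exists_desc_of_reflTransGen_step {G : CausalGraph V} {C : Set V} {x y : V × Bool}
    (h : Relation.ReflTransGen (G.Step (fun v => ∃ d ∈ C, G.Desc v d) C) x y)
    (hx : x.2 = true) (hy : y.2 = false) : ∃ d ∈ C, G.Desc x.1 d := by
  induction h using Relation.ReflTransGen.head_induction_on with
  | refl => simp [hx] at hy
  | @head a c hac _ ih =>
    cases hc : c.2 with
    | false => exact hac.2.1 ⟨hx, hc⟩
    | true =>
      obtain ⟨d, hd, hcd⟩ := ih hc
      exact ⟨d, hd, hcd.head (by simpa [hc] using hac.1)⟩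

theorem reflTransGen_step_mem_of_desc {G : CausalGraph V} {C : Set V} {x y : V × Bool}
    (h : Relation.ReflTransGen (G.Step (fun v => ∃ d ∈ C, G.Desc v d) C) x y) :
    Relation.ReflTransGen (G.Step (· ∈ C) C) x y := by
  induction h with
  | refl => exact .refl
  | @tail b c _ hbc ih =>
    obtain ⟨v, p⟩ := b
    obtain ⟨he, hcol, hnon⟩ := hbc
    by_cases hp : p = true ∧ c.2 = false ∧ v ∉ C
    · obtain ⟨rfl, hc, hv⟩ := hp
      obtain ⟨d, hd, hvd⟩ := hcol ⟨rfl, hc⟩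
      exact (ih.trans (reflTransGen_step_turn hv hd hvd)).tail ⟨he, by simp, fun _ => hv⟩
    · refine ih.tail ⟨he, fun h => ?_, hnon⟩
      by_contra hv
      exact hp ⟨h.1, h.2, hv⟩

end CausalGraph

/-- In a DAG, for pairwise disjoint vertex sets `A`, `B`, `C`, there is a
path from `A` to `B` open given `C` iff there is a way from `A` to `B` open given `C`. -/
theorem open_path_iff_open_way
    {V : Type} [Fintype V] (G : CausalGraph V) (hG : G.Acyclic)
    (A B C : Set V) (hAB : Disjoint A B) (hAC : Disjoint A C) (hBC : Disjoint B C) :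
    (∃ w : G.Walk, w.IsPath ∧ w.first ∈ A ∧ w.last ∈ B ∧ w.PathOpen C) ↔
    (∃ w : G.Walk, w.IsWay ∧ w.first ∈ A ∧ w.last ∈ B ∧ w.WayOpen C) := by
  constructor
  · rintro ⟨w, -, hA, hB, hw⟩
    obtain ⟨d, hd⟩ := CausalGraph.Walk.OpenWith.reflTransGen_step
      (P := fun v => ∃ d ∈ C, G.Desc v d) hw (hAC.notMem_of_mem_left hA)
    obtain ⟨n, s, h0, hn, hs, hmin⟩ := CausalGraph.exists_chain_without_shortcut
      (E := fun x => x.1 ∈ B) hB (CausalGraph.reflTransGen_step_mem_of_desc hd)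
    refine ⟨.ofStates n s hs, fun x => ?_, ?_, hn, CausalGraph.Walk.openWith_ofStates n s hs⟩
    · have hinj : ∀ i j, i < j → j ≤ n → s i ≠ s j := fun i j hij hj h =>
        hmin i j hij hj (by simp [h]) (by simp [h])
      refine le_of_le_of_eq (Set.ncard_le_ncard_of_injOn (t := (Set.univ : Set Bool))
        (fun j => (s j).2) (fun _ _ => Set.mem_univ _) ?_) (by simp)
      intro i hi j hj hij
      have h : s i = s j := Prod.ext (Eq.trans hi (Eq.symm hj)) hij
      rcases lt_trichotomy (i : ℕ) j with hlt | heq | hlt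
      · exact absurd h (hinj i j hlt (Nat.lt_succ_iff.mp j.2))
      · exact Fin.ext heq
      · exact absurd h.symm (hinj j i hlt (Nat.lt_succ_iff.mp i.2))
    · change (s 0).1 ∈ A
      simpa [h0] using hA
  · rintro ⟨w, -, hA, hB, hw⟩
    obtain ⟨d, hd⟩ := CausalGraph.Walk.OpenWith.reflTransGen_step
      (P := fun v => ∃ d ∈ C, G.Desc v d) (C := C)
      ⟨fun j hj => ⟨_, hw.1 j hj, Relation.ReflTransGen.refl⟩, hw.2⟩ (hAC.notMem_of_mem_left hA)
    obtain ⟨n, s, h0, hn, hs, hmin⟩ := CausalGraph.exists_chain_without_shortcut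
      (E := fun x => x.1 ∈ B) hB hd
    refine ⟨.ofStates n s hs, ?_, ?_, hn, CausalGraph.Walk.openWith_ofStates n s hs⟩
    · have hinj : ∀ i j, i < j → j ≤ n → (s i).1 ≠ (s j).1 := by
        intro i j hij hj h
        refine hmin i j hij hj (by simp [h]) fun z hz => ⟨by simpa [h] using hz.1, ?_, ?_⟩
        · rintro ⟨hi, hz'⟩
          cases hj' : (s j).2 with
          | true => simpa [h] using hz.2.1 ⟨hj', hz'⟩
          | false =>
            refine CausalGraph.exists_desc_of_reflTransGen_step ?_ hi hj'
            exact (reflTransGen_of_succ_of_le (fun k l => G.Step _ C (s k) (s l))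
              (fun k hk => hs k (lt_of_lt_of_le hk.2 hj)) hij.le).lift s fun _ _ h => h
        · rintro (hi | hz')
          · exact (hs i (by omega)).2.2 (.inl hi)
          · rw [h]
            exact hz.2.2 (.inr hz')
      intro i j hij
      rcases lt_trichotomy (i : ℕ) j with hlt | heq | hlt
      · exact absurd hij (hinj i j hlt (Nat.lt_succ_iff.mp j.2))
      · exact Fin.ext heq
      · exact absurd hij.symm (hinj j i hlt (Nat.lt_succ_iff.mp i.2))
    · change (s 0).1 ∈ A
      simpa [h0] using hA
end

section
/- Let G be a DAG, X and Y disjoint sets of vertices, and I ⊆ R ⊆ V with R disjoint from X ∪ Y. Then the set Z_(ii) satisfies conditions FD(2) and FD(3) relative to (X,Y): (Z_(ii) ⊥ X)_{G_underline(X)} holds and (Z_(ii) ⊥ Y | X)_{G_underline(Z_(ii))} holds. -/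
namespace CausalGraph

variable {V : Type}

/-- A walk of a subgraph, regarded as a walk of the larger graph. -/
def Walk.ofLE {G H : CausalGraph V} (h : ∀ u v, G.Edge u v → H.Edge u v) (w : G.Walk) :
    H.Walk where
  len := w.len
  vert := w.vert
  dir := w.dir
  valid i := by
    have hi := w.valid i
    split_ifs at hi ⊢ <;> exact h _ _ hi

theorem Walk.PathOpen.ofLE {G H : CausalGraph V} (h : ∀ u v, G.Edge u v → H.Edge u v)
    {w : G.Walk} {C : Set V} (hw : w.PathOpen C) : (w.ofLE h).PathOpen C := by
  refine ⟨fun j hj => ?_, hw.2⟩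
  obtain ⟨d, hd, hjd⟩ := hw.1 j hj
  exact ⟨d, hd, Relation.ReflTransGen.mono h _ _ hjd⟩

/-- Removing the edges out of a larger set `T ⊇ S` removes more edges. -/
theorem underline_edge_anti (G : CausalGraph V) {S T : Set V} (hST : S ⊆ T) (u v : V)
    (h : (G.underline T).Edge u v) : (G.underline S).Edge u v :=
  ⟨h.1, fun hu => h.2 (hST hu)⟩

/-- A separating set that witnesses membership in `Zii` is itself contained in `Zii`. -/
theorem insert_subset_Zii {G : CausalGraph V} {X Y R S : Set V} {z : V}
    (hz : z ∈ G.Zi X R) (hS : S ⊆ G.Zi X R)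
    (hsep : (G.underline (insert z S)).dSep (insert z S) Y X) :
    insert z S ⊆ G.Zii X Y R := by
  have hzS : insert z S ⊆ G.Zi X R := Set.insert_subset hz hS
  intro s hs
  refine ⟨hzS hs, insert z S, hzS, ?_⟩
  rwa [Set.insert_eq_of_mem hs]

end CausalGraph

/-- The set `Z_(ii)` satisfies FD(2) and FD(3) relative to `(X, Y)`. -/
theorem Zii_satisfies_FD2_FD3
    {V : Type} [Fintype V] (G : CausalGraph V) (hG : G.Acyclic)
    (X Y I R : Set V) (hXY : Disjoint X Y) (hIR : I ⊆ R) (hR : Disjoint R (X ∪ Y)) :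
    (G.underline X).dSep (G.Zii X Y R) X ∅ ∧
    (G.underline (G.Zii X Y R)).dSep (G.Zii X Y R) Y X := by
  constructor
  · rintro ⟨w, hw, hfirst, hlast, hopen⟩
    exact hfirst.1.2 ⟨w, hw, rfl, hlast, hopen⟩
  · rintro ⟨w, hw, hfirst, hlast, hopen⟩
    obtain ⟨hz, S, hS, hsep⟩ := hfirst
    have hle := G.underline_edge_anti (CausalGraph.insert_subset_Zii hz hS hsep)
    exact hsep ⟨w.ofLE hle, hw, Set.mem_insert _ _, hlast, hopen.ofLE hle⟩
end

section
/- Let G be a DAG, X and Y disjoint sets of vertices, and I ⊆ R ⊆ V with R disjoint from X ∪ Y. Then there exists an FD set Z relative to (X,Y) with I ⊆ Z ⊆ R if and only if I ⊆ Z_(ii) and every directed path from a vertex of X to a vertex of Y contains a vertex of Z_(ii); moreover, in this case Z_(ii) itself is an FD set relative to (X,Y) with I ⊆ Z_(ii) ⊆ R. -/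
namespace CausalGraph

variable {V : Type}

/-- Removing edges preserves d-separation. -/
theorem dSep.mono_edge {G H : CausalGraph V} {A B C : Set V}
    (hle : ∀ u v, H.Edge u v → G.Edge u v) (h : G.dSep A B C) : H.dSep A B C := by
  rintro ⟨w, hpath, hfirst, hlast, hcoll, hnon⟩
  refine h ⟨⟨w.len, w.vert, w.dir, fun i => ?_⟩, hpath, hfirst, hlast, fun j hj => ?_, hnon⟩
  · have := w.valid i
    split_ifs at this ⊢ <;> exact hle _ _ this
  · obtain ⟨d, hd, hdesc⟩ := hcoll j hj
    exact ⟨d, hd, Relation.ReflTransGen.mono hle _ _ hdesc⟩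

theorem dSep.mono_left {G : CausalGraph V} {A A' B C : Set V} (hA : A' ⊆ A)
    (h : G.dSep A B C) : G.dSep A' B C :=
  fun ⟨w, hpath, hfirst, hrest⟩ => h ⟨w, hpath, hA hfirst, hrest⟩

theorem dSep_iff_forall_singleton {G : CausalGraph V} {A B C : Set V} :
    G.dSep A B C ↔ ∀ a ∈ A, G.dSep {a} B C :=
  ⟨fun h _ ha => h.mono_left (Set.singleton_subset_iff.2 ha),
    fun h ⟨w, hpath, hfirst, hrest⟩ => h _ hfirst ⟨w, hpath, rfl, hrest⟩⟩

theorem dSep.underline_mono {G : CausalGraph V} {S T A B C : Set V} (hST : S ⊆ T)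
    (h : (G.underline S).dSep A B C) : (G.underline T).dSep A B C :=
  dSep.mono_edge (G := G.underline S) (fun _ _ huv => ⟨huv.1, fun hu => huv.2 (hST hu)⟩) h

theorem Intercepts.mono {G : CausalGraph V} {X Y Z Z' : Set V} (hZ : Z ⊆ Z')
    (h : G.Intercepts X Y Z) : G.Intercepts X Y Z' := fun w hpath hdir hfirst hlast =>
  (h w hpath hdir hfirst hlast).imp fun _ hj => hZ hj

/-- `Z_(ii)` contains every subset of `Z_(i)` that satisfies the third front-door condition. -/
theorem subset_Zii {G : CausalGraph V} {X Y R T : Set V} (hT : T ⊆ G.Zi X R)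
    (h : (G.underline T).dSep T Y X) : T ⊆ G.Zii X Y R := fun t ht =>
  ⟨hT ht, T, hT, by rwa [Set.insert_eq_of_mem ht]⟩

/-- `Z_(ii)` satisfies the third front-door condition. -/
theorem dSep_Zii (G : CausalGraph V) (X Y R : Set V) :
    (G.underline (G.Zii X Y R)).dSep (G.Zii X Y R) Y X := by
  refine dSep_iff_forall_singleton.2 fun z hz => ?_
  obtain ⟨hzi, S, hS, hsep⟩ := hz
  have hsub : insert z S ⊆ G.Zii X Y R := subset_Zii (Set.insert_subset hzi hS) hsep
  exact (hsep.underline_mono hsub).mono_left (by simp)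

theorem IsFDSet.subset_Zii {G : CausalGraph V} {X Y R Z : Set V} (hZR : Z ⊆ R)
    (h : G.IsFDSet X Y Z) : Z ⊆ G.Zii X Y R :=
  have ⟨_, _, _, _, hZX, hZY⟩ := h
  CausalGraph.subset_Zii
    (fun z hz => ⟨hZR hz, dSep_iff_forall_singleton.1 hZX z hz⟩) hZY

theorem Zii_subset (G : CausalGraph V) (X Y R : Set V) : G.Zii X Y R ⊆ R :=
  fun _ hz => hz.1.1

theorem isFDSet_Zii {G : CausalGraph V} {X Y R : Set V} (hXY : Disjoint X Y)
    (hR : Disjoint R (X ∪ Y)) (h : G.Intercepts X Y (G.Zii X Y R)) :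
    G.IsFDSet X Y (G.Zii X Y R) := by
  have hdisj := Disjoint.mono_left (G.Zii_subset X Y R) hR
  rw [Set.disjoint_union_right] at hdisj
  exact ⟨hXY, hdisj.1.symm, hdisj.2.symm, h,
    dSep_iff_forall_singleton.2 fun _ hz => hz.1.2, G.dSep_Zii X Y R⟩

end CausalGraph

/-- An FD set `Z` relative to `(X, Y)` with `I ⊆ Z ⊆ R` exists iff
`I ⊆ Z_(ii)` and `Z_(ii)` intercepts all directed paths from `X` to `Y`; moreover,
in that case `Z_(ii)` itself is such an FD set. -/
theorem fdSet_exists_iff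
    {V : Type} [Fintype V] (G : CausalGraph V) (hG : G.Acyclic)
    (X Y I R : Set V) (hXY : Disjoint X Y) (hIR : I ⊆ R) (hR : Disjoint R (X ∪ Y)) :
    ((∃ Z : Set V, I ⊆ Z ∧ Z ⊆ R ∧ G.IsFDSet X Y Z) ↔
      (I ⊆ G.Zii X Y R ∧ G.Intercepts X Y (G.Zii X Y R))) ∧
    ((I ⊆ G.Zii X Y R ∧ G.Intercepts X Y (G.Zii X Y R)) →
      I ⊆ G.Zii X Y R ∧ G.Zii X Y R ⊆ R ∧ G.IsFDSet X Y (G.Zii X Y R)) := by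
  have hZii : I ⊆ G.Zii X Y R ∧ G.Intercepts X Y (G.Zii X Y R) →
      I ⊆ G.Zii X Y R ∧ G.Zii X Y R ⊆ R ∧ G.IsFDSet X Y (G.Zii X Y R) :=
    fun ⟨hI, hint⟩ => ⟨hI, G.Zii_subset X Y R, CausalGraph.isFDSet_Zii hXY hR hint⟩
  refine ⟨⟨?_, fun h => ⟨_, hZii h⟩⟩, hZii⟩
  rintro ⟨Z, hIZ, hZR, hZ⟩
  have hsub := hZ.subset_Zii hZR
  exact ⟨hIZ.trans hsub, hZ.2.2.2.1.mono hsub⟩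
end

section
/- Let G be a DAG, X and Y disjoint sets of vertices, and I ⊆ R ⊆ V with R disjoint from X ∪ Y. Call a vertex V forbidden if V ∉ Z_(i) or there exists no S ⊆ Z_(i) with ({V} ∪ S ⊥ Y | X)_{G_underline({V} ∪ S)}. Then a vertex V is forbidden if and only if (A) V ∉ Z_(i), or (B) there is an edge from some vertex of Y into V, or (C) there exists a BD way from V to a vertex of Y consisting of at least three vertices that is open given X and all of whose nonterminal vertices are forbidden. -/
/-- A vertex `v` is forbidden if `v ∉ Z_(i)` or there is no `S ⊆ Z_(i)` with
`({v} ∪ S ⊥ Y | X)` in `G_underline({v} ∪ S)`. -/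
def CausalGraph.Forbidden {V : Type} (G : CausalGraph V) (X Y R : Set V) (v : V) : Prop :=
  v ∉ G.Zi X R ∨
  ¬ ∃ S ⊆ G.Zi X R, (G.underline (insert v S)).dSep (insert v S) Y X

namespace CausalGraph

variable {V : Type} {G H : CausalGraph V} {P : V → Prop} {C : Set V}

lemma Acyclic.underline (hG : G.Acyclic) (S : Set V) : (G.underline S).Acyclic :=
  fun v h => hG v (Relation.TransGen.mono (fun _ _ e => e.1) v v h)

lemma underline_edge_mono {S T : Set V} (hST : S ⊆ T) {u v : V}
    (h : (G.underline T).Edge u v) : (G.underline S).Edge u v :=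
  ⟨h.1, fun hu => h.2 (hST hu)⟩

/-- The first `n` steps of the vertex sequence `f`, with edge directions `d`, form a walk in `G`
whose interior colliders satisfy `P` and whose interior non-colliders avoid `C`. -/
structure OpenSeq (G : CausalGraph V) (P : V → Prop) (C : Set V) (n : ℕ) (f : ℕ → V)
    (d : ℕ → Bool) : Prop where
  edge_of_true : ∀ k < n, d k = true → G.Edge (f k) (f (k + 1))
  edge_of_false : ∀ k < n, d k = false → G.Edge (f (k + 1)) (f k)
  collider : ∀ k, k + 1 < n → d k = true → d (k + 1) = false → P (f (k + 1))
  nonCollider : ∀ k, k + 1 < n → (d k = false ∨ d (k + 1) = true) → f (k + 1) ∉ C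

namespace OpenSeq

variable {n : ℕ} {f : ℕ → V} {d : ℕ → Bool}

lemma mono (h : G.OpenSeq P C n f d) (hGH : ∀ u v, G.Edge u v → H.Edge u v) :
    H.OpenSeq P C n f d :=
  ⟨fun k hk hd => hGH _ _ (h.edge_of_true k hk hd),
    fun k hk hd => hGH _ _ (h.edge_of_false k hk hd), h.collider, h.nonCollider⟩

/-- Every edge of the walk has its tail outside `S`, so the walk survives in `G.underline S`. -/
lemma underline (h : G.OpenSeq P C n f d) {S : Set V}
    (hfirst : 0 < n → d 0 = false) (hS : ∀ k, 0 < k → k ≤ n → f k ∉ S) :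
    (G.underline S).OpenSeq P C n f d where
  edge_of_true k hk hd := by
    refine ⟨h.edge_of_true k hk hd, hS k ?_ hk.le⟩
    rcases Nat.eq_zero_or_pos k with rfl | h0
    · simp [hfirst hk] at hd
    · exact h0
  edge_of_false k hk hd := ⟨h.edge_of_false k hk hd, hS _ k.succ_pos hk⟩
  collider := h.collider
  nonCollider := h.nonCollider

/-- The segment between two occurrences of a vertex can be removed when the condition at the
junction is met. -/
lemma cut (h : G.OpenSeq P C n f d) {i j : ℕ} (hij : i < j) (hjn : j ≤ n) (hf : f i = f j)
    (hP : ∀ k, i = k + 1 → j < n → d k = true → d j = false → P (f i))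
    (hC : ∀ k, i = k + 1 → j < n → (d k = false ∨ d j = true) → f i ∉ C) :
    ∃ f' d', G.OpenSeq P C (n - (j - i)) f' d' ∧ f' 0 = f 0 ∧ f' (n - (j - i)) = f n := by
  obtain ⟨h1, h2, h3, h4⟩ := h
  obtain ⟨m, rfl⟩ : ∃ m, j = i + m := ⟨j - i, by omega⟩
  rw [Nat.add_sub_cancel_left]
  refine ⟨fun k => if k ≤ i then f k else f (k + m),
    fun k => if k < i then d k else d (k + m), ⟨?_, ?_, ?_, ?_⟩, by simp, ?_⟩
  · intro k hk hd
    rcases lt_trichotomy k i with hki | rfl | hki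
    · have := h1 k (by omega)
      grind
    · have := h1 (k + m) (by omega)
      grind
    · have := h1 (k + m) (by omega)
      grind
  · intro k hk hd
    rcases lt_trichotomy k i with hki | rfl | hki
    · have := h2 k (by omega)
      grind
    · have := h2 (k + m) (by omega)
      grind
    · have := h2 (k + m) (by omega)
      grind
  · intro k hk hd hd'
    rcases lt_trichotomy (k + 1) i with hki | rfl | hki
    · have := h3 k (by omega)
      grind
    · have := hP k rfl (by omega)
      grind
    · have := h3 (k + m) (by omega)
      grind
  · intro k hk hd
    rcases lt_trichotomy (k + 1) i with hki | rfl | hki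
    · have := h4 k (by omega)
      grind
    · have := hC k rfl (by omega)
      grind
    · have := h4 (k + m) (by omega)
      grind
  · dsimp only
    split_ifs with hle
    · rw [show n - m = i by omega, hf, show i + m = n by omega]
    · rw [show n - m + m = n by omega]

/-- A walk leaving `f i` forwards either stays directed, or meets a collider that is a descendant
of `f i`, in which case `f i` satisfies `P`. -/
lemma transGen_or (h : G.OpenSeq P C n f d) (hP : ∀ u v, G.Edge u v → P v → P u) {i : ℕ}
    (hd : d i = true) :
    ∀ m, i + m < n → (d (i + m) = true ∧ Relation.TransGen G.Edge (f i) (f (i + m + 1))) ∨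
      P (f i) := by
  have hdesc : ∀ u v, Relation.TransGen G.Edge u v → P v → P u := by
    intro u v huv
    induction huv using Relation.TransGen.head_induction_on with
    | single e => exact hP _ _ e
    | head e _ ih => exact fun hv => hP _ _ e (ih hv)
  intro m
  induction m with
  | zero => exact fun hi => .inl ⟨hd, .single (h.edge_of_true i hi hd)⟩
  | succ m ih =>
    intro hm
    rcases ih (by omega) with ⟨hdm, ht⟩ | hp
    · rcases hd' : d (i + (m + 1)) with _ | _
      · exact .inr (hdesc _ _ ht (h.collider (i + m) hm hdm hd'))
      · exact .inl ⟨rfl, ht.tail (h.edge_of_true _ hm hd')⟩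
    · exact .inr hp

/-- A shortest open walk in a DAG is a path, provided that `P` is inherited by ancestors. -/
lemma exists_injOn (hG : G.Acyclic) (hP : ∀ u v, G.Edge u v → P v → P u)
    (h : G.OpenSeq P C n f d) :
    ∃ n' f' d', G.OpenSeq P C n' f' d' ∧ f' 0 = f 0 ∧ f' n' = f n ∧
      ∀ i j, i < j → j ≤ n' → f' i ≠ f' j := by
  induction n using Nat.strong_induction_on generalizing f d with
  | _ n ih =>
    by_cases hinj : ∀ i j, i < j → j ≤ n → f i ≠ f j
    · exact ⟨n, f, d, h, rfl, rfl, hinj⟩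
    push Not at hinj
    obtain ⟨i, j, hij, hjn, hf⟩ := hinj
    obtain ⟨f₁, d₁, h₁, h0, hn⟩ := h.cut hij hjn hf (by
        rintro k rfl hj hd hd'
        rcases hdi : d (k + 1) with _ | _
        · exact h.collider k (by omega) hd hdi
        · rcases h.transGen_or hP hdi (j - (k + 1) - 1) (by omega) with ⟨-, ht⟩ | hp
          · rw [show k + 1 + (j - (k + 1) - 1) + 1 = j by omega, ← hf] at ht
            exact (hG _ ht).elim
          · exact hp) (by
        rintro k rfl hj (hd | hd)
        · exact h.nonCollider k (by omega) (.inl hd)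
        · have := h.nonCollider (j - 1) (by omega)
          rw [show j - 1 + 1 = j by omega] at this
          exact hf ▸ this (.inr hd))
    obtain ⟨n', f', d', h', h0', hn', hshort⟩ := ih _ (by omega) h₁
    exact ⟨n', f', d', h', h0'.trans h0, hn'.trans hn, hshort⟩

/-- A shortest open walk visits no vertex three times. -/
lemma exists_atMostTwice (h : G.OpenSeq (· ∈ C) C n f d) (h0 : f 0 ∉ C) (hn : f n ∉ C) :
    ∃ n' f' d', G.OpenSeq (· ∈ C) C n' f' d' ∧ f' 0 = f 0 ∧ f' n' = f n ∧
      ∀ i j k, i < j → j < k → k ≤ n' → f' i = f' j → f' j ≠ f' k := by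
  induction n using Nat.strong_induction_on generalizing f d with
  | _ n ih =>
    by_cases hcut : ∃ i j, i < j ∧ j ≤ n ∧ f i = f j ∧
        (∀ k, i = k + 1 → j < n → d k = true → d j = false → f i ∈ C) ∧
        (∀ k, i = k + 1 → j < n → (d k = false ∨ d j = true) → f i ∉ C)
    · obtain ⟨i, j, hij, hjn, hf, hP, hC⟩ := hcut
      obtain ⟨f₁, d₁, h₁, h01, hn1⟩ := h.cut hij hjn hf hP hC
      obtain ⟨n', f', d', h', h0', hn', hshort⟩ :=
        ih _ (by omega) h₁ (by rwa [h01]) (by rwa [hn1])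
      exact ⟨n', f', d', h', h0'.trans h01, hn'.trans hn1, hshort⟩
    · refine ⟨n, f, d, h, rfl, rfl, ?_⟩
      have key : ∀ i j, i < j → j ≤ n → f i = f j →
          ∃ k l, i = k + 1 ∧ j = l + 1 ∧ j < n ∧ d k = true ∧ d l = false ∧ d j = false := by
        intro i j hij hj hf
        by_contra hcon
        refine hcut ⟨i, j, hij, hj, hf, ?_, ?_⟩
        · rintro k rfl hjn hd hd'
          obtain ⟨l, rfl⟩ : ∃ l, j = l + 1 := ⟨j - 1, by omega⟩
          rcases hdl : d l with _ | _
          · exact (hcon ⟨k, l, rfl, rfl, hjn, hd, hdl, hd'⟩).elim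
          · rw [hf]
            exact h.collider l hjn hdl hd'
        · rintro k rfl hjn (hd | hd)
          · exact h.nonCollider k (by omega) (.inl hd)
          · obtain ⟨l, rfl⟩ : ∃ l, j = l + 1 := ⟨j - 1, by omega⟩
            rw [hf]
            exact h.nonCollider l hjn (.inr hd)
      intro i j k hij hjk hk hf hf'
      obtain ⟨_, l, -, rfl, -, -, hl, -⟩ := key i j hij (by omega) hf
      obtain ⟨l', _, hl', -, -, hd, -⟩ := key _ k hjk hk hf'
      obtain rfl : l = l' := by omega
      simp [hl] at hd

lemma snoc (h : G.OpenSeq P C (n + 1) f d) {u : V} {b : Bool}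
    (htrue : b = true → G.Edge (f (n + 1)) u) (hfalse : b = false → G.Edge u (f (n + 1)))
    (hP : d n = true → b = false → P (f (n + 1)))
    (hC : d n = false ∨ b = true → f (n + 1) ∉ C) :
    ∃ f' d', G.OpenSeq P C (n + 2) f' d' ∧ f' 0 = f 0 ∧ f' (n + 2) = u ∧ d' (n + 1) = b := by
  obtain ⟨h1, h2, h3, h4⟩ := h
  refine ⟨fun k => if k ≤ n + 1 then f k else u, fun k => if k ≤ n then d k else b,
    ⟨?_, ?_, ?_, ?_⟩, by simp, by simp, by simp⟩
  · intro k hk hd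
    rcases Nat.lt_or_eq_of_le (Nat.lt_succ_iff.mp hk) with hk | rfl
    · have := h1 k
      grind
    · grind
  · intro k hk hd
    rcases Nat.lt_or_eq_of_le (Nat.lt_succ_iff.mp hk) with hk | rfl
    · have := h2 k
      grind
    · grind
  · intro k hk hd hd'
    rcases Nat.lt_or_eq_of_le (Nat.lt_succ_iff.mp hk) with hk | hk
    · have := h3 k
      grind
    · grind
  · intro k hk hd
    rcases Nat.lt_or_eq_of_le (Nat.lt_succ_iff.mp hk) with hk | hk
    · have := h4 k
      grind
    · grind

/-- An open walk arriving at an ancestor `v` of `C` along an edge into `v` can be continued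
against any other edge into `v`, by a detour to `C`. -/
lemma detour {v c : V} (hc : c ∈ C) (hv : G.Desc v c) :
    ∀ (n : ℕ) (f : ℕ → V) (d : ℕ → Bool) (u : V), G.OpenSeq (· ∈ C) C (n + 1) f d →
      f (n + 1) = v → d n = true → G.Edge u v →
      ∃ n' f' d', G.OpenSeq (· ∈ C) C (n' + 1) f' d' ∧ f' 0 = f 0 ∧ f' (n' + 1) = u ∧
        d' n' = false := by
  have collide : ∀ v ∈ C, ∀ (n : ℕ) (f : ℕ → V) (d : ℕ → Bool) (u : V),
      G.OpenSeq (· ∈ C) C (n + 1) f d → f (n + 1) = v → d n = true → G.Edge u v →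
      ∃ n' f' d', G.OpenSeq (· ∈ C) C (n' + 1) f' d' ∧ f' 0 = f 0 ∧ f' (n' + 1) = u ∧
        d' n' = false := by
    rintro v hv n f d u h rfl hd he
    exact ⟨n + 1, h.snoc (b := false) (by simp) (fun _ => he) (fun _ _ => hv) (by simp [hd])⟩
  induction hv using Relation.ReflTransGen.head_induction_on with
  | refl => exact collide c hc
  | @head v v' e _ ih =>
    by_cases hvC : v ∈ C
    · exact collide v hvC
    rintro n f d u h rfl hd he
    obtain ⟨f₁, d₁, h₁, h01, hn1, hd1⟩ :=
      h.snoc (b := true) (fun _ => e) (by simp) (by simp) (fun _ => hvC)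
    obtain ⟨n₂, f₂, d₂, h₂, h02, hn2, hd2⟩ := ih (n + 1) f₁ d₁ _ h₁ hn1 hd1 e
    obtain ⟨f₃, d₃, h₃, h03, hn3, hd3⟩ := h₂.snoc (u := u) (b := false) (by simp)
      (fun _ => by rwa [hn2]) (by simp [hd2]) (fun _ => by rwa [hn2])
    exact ⟨n₂ + 1, f₃, d₃, h₃, h03.trans (h02.trans h01), hn3, hd3⟩

/-- If every collider has a descendant in `C`, then detours make every collider lie in `C`. -/
lemma exists_collider_mem (h : G.OpenSeq (fun v => ∃ c ∈ C, G.Desc v c) C n f d) :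
    ∃ n' f' d', G.OpenSeq (· ∈ C) C n' f' d' ∧ f' 0 = f 0 ∧ f' n' = f n := by
  rcases n with _ | n
  · exact ⟨0, f, d, ⟨by simp, by simp, by simp, by simp⟩, rfl, rfl⟩
  have key : ∀ k ≤ n, ∃ n' f' d', G.OpenSeq (· ∈ C) C (n' + 1) f' d' ∧ f' 0 = f 0 ∧
      f' (n' + 1) = f (k + 1) ∧ d' n' = d k := by
    intro k
    induction k with
    | zero =>
      intro hk
      refine ⟨0, f, d, ⟨?_, ?_, by simp, by simp⟩, rfl, rfl, rfl⟩
      · exact fun k hk => h.edge_of_true k (by omega)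
      · exact fun k hk => h.edge_of_false k (by omega)
    | succ k ih =>
      intro hk
      obtain ⟨n₁, f₁, d₁, h₁, h01, hn1, hd1⟩ := ih (by omega)
      by_cases hcol : d k = true ∧ d (k + 1) = false
      · obtain ⟨c, hc, hv⟩ := h.collider k (by omega) hcol.1 hcol.2
        obtain ⟨n₂, f₂, d₂, h₂, h02, hn2, hd2⟩ := detour hc hv n₁ f₁ d₁ _ h₁ hn1
          (hd1.trans hcol.1) (h.edge_of_false (k + 1) (by omega) hcol.2)
        exact ⟨n₂, f₂, d₂, h₂, h02.trans h01, hn2, hd2.trans hcol.2.symm⟩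
      · obtain ⟨f₂, d₂, h₂, h02, hn2, hd2⟩ := h₁.snoc (u := f (k + 1 + 1)) (b := d (k + 1))
          (by rw [hn1]; exact h.edge_of_true (k + 1) (by omega))
          (by rw [hn1]; exact h.edge_of_false (k + 1) (by omega))
          (fun a b => (hcol ⟨hd1 ▸ a, b⟩).elim)
          (by rw [hn1, hd1]; exact h.nonCollider k (by omega))
        exact ⟨n₁ + 1, f₂, d₂, h₂, h02.trans h01, hn2, hd2⟩
  obtain ⟨n', f', d', h', h0, hn, -⟩ := key n le_rfl
  exact ⟨n' + 1, f', d', h', h0, hn⟩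

/-- The walk given by a sequence. -/
def toWalk (h : G.OpenSeq P C n f d) : G.Walk where
  len := n
  vert i := f i
  dir i := d i
  valid i := by
    rcases hd : d i with _ | _
    · simpa using h.edge_of_false i i.2 hd
    · simpa using h.edge_of_true i i.2 hd

lemma collider_toWalk (h : G.OpenSeq P C n f d) (j : Fin (n + 1))
    (hj : h.toWalk.ColliderAt j) : P (f j) := by
  obtain ⟨j, hjn⟩ := j
  obtain ⟨h0, h1, h2, h3⟩ := hj
  obtain ⟨k, rfl⟩ : ∃ k, j = k + 1 := ⟨j - 1, (Nat.sub_add_cancel h0).symm⟩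
  exact h.collider k h1 h2 h3

lemma nonCollider_toWalk (h : G.OpenSeq P C n f d) (j : Fin (n + 1))
    (hj : h.toWalk.NonColliderAt j) : f j ∉ C := by
  obtain ⟨j, hjn⟩ := j
  obtain ⟨h0, h1, h2⟩ := hj
  obtain ⟨k, rfl⟩ : ∃ k, j = k + 1 := ⟨j - 1, (Nat.sub_add_cancel h0).symm⟩
  exact h.nonCollider k h1 h2

end OpenSeq

/-- The sequence given by a walk. -/
lemma Walk.exists_openSeq (w : G.Walk) (hP : ∀ j, w.ColliderAt j → P (w.vert j))
    (hC : ∀ j, w.NonColliderAt j → w.vert j ∉ C) :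
    ∃ f d, G.OpenSeq P C w.len f d ∧ (∀ i : Fin (w.len + 1), f i = w.vert i) ∧
      ∀ i : Fin w.len, d i = w.dir i := by
  obtain ⟨f, hf⟩ : ∃ f : ℕ → V, ∀ i (hi : i < w.len + 1), f i = w.vert ⟨i, hi⟩ :=
    ⟨fun k => if hk : k < w.len + 1 then w.vert ⟨k, hk⟩ else w.first, fun _ hi => dif_pos hi⟩
  obtain ⟨d, hd⟩ : ∃ d : ℕ → Bool, ∀ i (hi : i < w.len), d i = w.dir ⟨i, hi⟩ :=
    ⟨fun k => if hk : k < w.len then w.dir ⟨k, hk⟩ else true, fun _ hi => dif_pos hi⟩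
  refine ⟨f, d, ⟨?_, ?_, ?_, ?_⟩, fun i => hf i i.2, fun i => hd i i.2⟩
  · intro k hk hdk
    rw [hd k hk] at hdk
    have := w.valid ⟨k, hk⟩
    rw [if_pos hdk] at this
    rw [hf k (by omega), hf (k + 1) (by omega)]
    exact this
  · intro k hk hdk
    rw [hd k hk] at hdk
    have := w.valid ⟨k, hk⟩
    rw [if_neg (by simp [hdk])] at this
    rw [hf k (by omega), hf (k + 1) (by omega)]
    exact this
  · intro k hk h1 h2
    rw [hd k (by omega)] at h1
    rw [hd (k + 1) hk] at h2
    rw [hf (k + 1) (by omega)]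
    exact hP _ ⟨k.succ_pos, hk, h1, h2⟩
  · intro k hk h1
    rw [hd k (by omega), hd (k + 1) hk] at h1
    rw [hf (k + 1) (by omega)]
    exact hC _ ⟨k.succ_pos, hk, h1⟩

/-- In a DAG, d-separation can be tested on walks whose colliders lie in the conditioning set. -/
lemma dSep_iff_openSeq (hG : G.Acyclic) (A B C : Set V) :
    G.dSep A B C ↔ ∀ n f d, G.OpenSeq (· ∈ C) C n f d → f 0 ∈ A → f n ∉ B := by
  constructor
  · intro hsep n f d h hA hB
    have h' : G.OpenSeq (fun v => ∃ c ∈ C, G.Desc v c) C n f d :=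
      ⟨h.edge_of_true, h.edge_of_false,
        fun k hk h1 h2 => ⟨_, h.collider k hk h1 h2, .refl⟩, h.nonCollider⟩
    obtain ⟨n', f', d', h', h0, hn, hinj⟩ :=
      h'.exists_injOn hG fun u v e ⟨c, hc, hv⟩ => ⟨c, hc, hv.head e⟩
    refine hsep ⟨h'.toWalk, ?_, ?_, ?_, h'.collider_toWalk, h'.nonCollider_toWalk⟩
    · intro i j hij
      change f' i = f' j at hij
      rcases lt_trichotomy i j with hlt | heq | hlt
      · exact (hinj i j hlt (Nat.lt_succ_iff.mp j.2) hij).elim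
      · exact heq
      · exact (hinj j i hlt (Nat.lt_succ_iff.mp i.2) hij.symm).elim
    · change f' 0 ∈ A
      rwa [h0]
    · change f' n' ∈ B
      rwa [hn]
  · rintro hno ⟨w, -, hA, hB, hcol, hnon⟩
    obtain ⟨f, d, h, hf, -⟩ := w.exists_openSeq
      (P := fun v => ∃ c ∈ C, G.Desc v c) hcol hnon
    obtain ⟨n', f', d', h', h0, hn⟩ := h.exists_collider_mem
    refine hno n' f' d' h' ?_ ?_
    · rw [h0]
      exact (hf 0).symm ▸ hA
    · rw [hn]
      exact (hf (Fin.last _)).symm ▸ hB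

lemma OpenSeq.isWay_toWalk {n : ℕ} {f : ℕ → V} {d : ℕ → Bool} (h : G.OpenSeq P C n f d)
    (htwice : ∀ i j k, i < j → j < k → k ≤ n → f i = f j → f j ≠ f k) :
    h.toWalk.IsWay := by
  intro x
  by_contra! hcard
  obtain ⟨a, b, c, ha, hb, hc, hab, hac, hbc⟩ := (Set.two_lt_ncard_iff (Set.toFinite _)).mp hcard
  change f a = x at ha
  change f b = x at hb
  change f c = x at hc
  have hab' : (a : ℕ) ≠ b := fun e => hab (Fin.ext e)
  have hac' : (a : ℕ) ≠ c := fun e => hac (Fin.ext e)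
  have hbc' : (b : ℕ) ≠ c := fun e => hbc (Fin.ext e)
  have hmax : ∀ i : Fin (n + 1), (i : ℕ) ≤ n := fun i => Nat.lt_succ_iff.mp i.2
  have ha' := hmax a
  have hb' := hmax b
  have hc' := hmax c
  grind

lemma not_forbidden_of_mem {X Y R T : Set V} (hT : T ⊆ G.Zi X R)
    (hsep : (G.underline T).dSep T Y X) {t : V} (ht : t ∈ T) : ¬ G.Forbidden X Y R t := by
  rintro (h | h)
  · exact h (hT ht)
  · exact h ⟨T, hT, by rwa [Set.insert_eq_of_mem ht]⟩

end CausalGraph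

/-- A vertex `v` is forbidden iff (A) `v ∉ Z_(i)`, or (B) there is an edge
from a vertex of `Y` into `v`, or (C) there is a BD way from `v` to `Y` with at least
three vertices that is open given `X` all of whose nonterminal vertices are forbidden. -/
theorem forbidden_characterization
    {V : Type} [Fintype V] (G : CausalGraph V) (hG : G.Acyclic)
    (X Y I R : Set V) (hXY : Disjoint X Y) (hIR : I ⊆ R) (hR : Disjoint R (X ∪ Y)) :
    ∀ v : V, G.Forbidden X Y R v ↔
      (v ∉ G.Zi X R ∨
       (∃ y ∈ Y, G.Edge y v) ∨
       ∃ w : G.Walk, w.IsWay ∧ w.IsBD ∧ w.first = v ∧ w.last ∈ Y ∧ 2 ≤ w.len ∧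
         w.WayOpen X ∧
         ∀ j : Fin (w.len + 1), 0 < (j : ℕ) → (j : ℕ) < w.len →
           G.Forbidden X Y R (w.vert j)) := by
  intro v
  have hRX : ∀ u ∈ G.Zi X R, u ∉ X := fun u hu hx => hR.le_bot ⟨hu.1, .inl hx⟩
  have hRY : ∀ u ∈ G.Zi X R, u ∉ Y := fun u hu hy => hR.le_bot ⟨hu.1, .inr hy⟩
  constructor
  · intro hv
    by_cases hvZ : v ∈ G.Zi X R
    swap
    · exact .inl hvZ
    refine .inr ?_
    set U : Set V := {u | ¬ G.Forbidden X Y R u} with hU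
    have hUZ : U ⊆ G.Zi X R := fun u hu => by_contra fun h => hu (.inl h)
    have hTZ : insert v U ⊆ G.Zi X R := Set.insert_subset hvZ hUZ
    have hnsep : ¬ (G.underline (insert v U)).dSep (insert v U) Y X := fun hsep =>
      CausalGraph.not_forbidden_of_mem hTZ hsep (Set.mem_insert v U) hv
    rw [CausalGraph.dSep_iff_openSeq (hG.underline _)] at hnsep
    push Not at hnsep
    obtain ⟨n₀, f₀, d₀, h₀, hfst, hlst⟩ := hnsep
    obtain ⟨n, f, d, h, h0, hn, htwice⟩ :=
      h₀.exists_atMostTwice (hRX _ (hTZ hfst)) (fun hx => hXY.le_bot ⟨hx, hlst⟩)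
    rw [← h0] at hfst
    rw [← hn] at hlst
    rcases eq_or_ne (f 0) v with hfv | hfv
    · have hpos : 0 < n := by
        rcases Nat.eq_zero_or_pos n with rfl | hpos
        · exact (hRY _ (hTZ hfst) hlst).elim
        · exact hpos
      have hd0 : d 0 = false := by
        rcases hd : d 0 with _ | _
        · rfl
        · exact ((h.edge_of_true 0 hpos hd).2 hfst).elim
      rcases Nat.lt_or_ge n 2 with hn2 | hn2
      · obtain rfl : n = 1 := by omega
        exact .inl ⟨f 1, hlst, hfv ▸ (h.edge_of_false 0 hpos hd0).1⟩
      · have hG' := h.mono (H := G) fun _ _ e => e.1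
        refine .inr ⟨hG'.toWalk, hG'.isWay_toWalk htwice, ⟨hpos, hd0⟩, hfv, hlst, hn2,
          ⟨hG'.collider_toWalk, hG'.nonCollider_toWalk⟩, ?_⟩
        rintro ⟨j, hjn⟩ hj0 hj
        change 0 < j at hj0
        change j < n at hj
        change G.Forbidden X Y R (f j)
        obtain ⟨k, rfl⟩ : ∃ k, j = k + 1 := ⟨j - 1, by omega⟩
        suffices hnot : f (k + 1) ∉ insert v U by
          by_contra hcon
          exact hnot (.inr hcon)
        rcases hdk : d k with _ | _
        · exact (h.edge_of_false k (by omega) hdk).2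
        rcases hdk' : d (k + 1) with _ | _
        · exact fun hmem => hRX _ (hTZ hmem) (h.collider k hj hdk hdk')
        · exact (h.edge_of_true _ hj hdk').2
    · have hf0 : f 0 ∈ U := hfst.resolve_left hfv
      have hf0' : ¬ G.Forbidden X Y R (f 0) := hf0
      unfold CausalGraph.Forbidden at hf0'
      push Not at hf0'
      obtain ⟨hz, S, hS, hsep⟩ := hf0'
      have hTS : insert (f 0) S ⊆ insert v U := fun t ht =>
        .inr (CausalGraph.not_forbidden_of_mem (Set.insert_subset hz hS) hsep ht)
      rw [CausalGraph.dSep_iff_openSeq (hG.underline _)] at hsep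
      exact (hsep n f d (h.mono fun _ _ => CausalGraph.underline_edge_mono hTS)
        (Set.mem_insert _ _) hlst).elim
  · intro hv
    by_cases hvZ : v ∈ G.Zi X R
    swap
    · exact .inl hvZ
    refine .inr ?_
    rintro ⟨S, hS, hsep⟩
    have hTZ : insert v S ⊆ G.Zi X R := Set.insert_subset hvZ hS
    have hgood := fun t => CausalGraph.not_forbidden_of_mem (t := t) hTZ hsep
    rw [CausalGraph.dSep_iff_openSeq (hG.underline _)] at hsep
    rcases hv with hv | ⟨y, hy, he⟩ | ⟨w, -, ⟨hpos, hd0⟩, hfirst, hlast, -, hopen, hforb⟩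
    · exact hv hvZ
    · refine hsep 1 (fun k => if k = 0 then v else y) (fun _ => false)
        ⟨by simp, ?_, by simp, by simp⟩ (by simp) (by simpa using hy)
      intro k hk _
      obtain rfl : k = 0 := by omega
      exact ⟨by simpa using he, fun hmem => hRY _ (hTZ hmem) (by simpa using hy)⟩
    · obtain ⟨f, d, h, hf, hd⟩ := w.exists_openSeq (P := (· ∈ X)) hopen.1 hopen.2
      have hfn : f w.len ∈ Y := (hf (Fin.last _)).symm ▸ hlast
      refine hsep w.len f d (h.underline (fun _ => (hd ⟨0, hpos⟩).trans hd0) ?_) ?_ hfn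
      · intro k hk0 hk hmem
        rcases Nat.lt_or_eq_of_le hk with hk | rfl
        · refine hgood _ hmem ?_
          have := hforb ⟨k, by omega⟩ hk0 hk
          rwa [← hf] at this
        · exact hRY _ (hTZ hmem) hfn
      · rw [show f 0 = v from (hf 0).trans hfirst]
        exact Set.mem_insert _ _
end

section
/- Let G be a DAG and X, Y disjoint sets of vertices, and let Z be an FD set relative to (X,Y) with I ⊆ Z ⊆ R. If Z can be written as Z = I ∪ Z_XY ∪ Z_ZY such that (1) for each W ∈ Z_XY there exists a directed path from a vertex of X through W to a vertex of Y containing no vertex of X other than its first vertex and containing no vertex of Z other than W, and (2) for each W ∈ Z_ZY there exists a proper BD way from I ∪ Z_XY to Y which contains an edge pointing out of W (facing in the direction of Y), contains no edge pointing out of any vertex of Z \ {W}, contains no vertex of X, and every collider on which lies in Z, then Z is I-inclusion minimal. -/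
namespace CausalGraph

variable {V : Type}

/-- `IsTrek E n k f`: the sequence `f 0, …, f n` follows `k` backward `E`-edges and then `n - k`
forward ones. -/
def IsTrek (E : V → V → Prop) (n k : ℕ) (f : ℕ → V) : Prop :=
  k ≤ n ∧ (∀ i < k, E (f (i + 1)) (f i)) ∧ ∀ i, k ≤ i → i < n → E (f i) (f (i + 1))

theorem exists_isTrek_backward {E : V → V → Prop} {t a : V} (h : Relation.ReflTransGen E t a) :
    ∃ n f, IsTrek E n n f ∧ f 0 = a ∧ f n = t := by
  induction h using Relation.ReflTransGen.head_induction_on with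
  | refl => exact ⟨0, fun _ => a, ⟨le_rfl, by simp, by omega⟩, rfl, rfl⟩
  | @head u v huv _ ih =>
    obtain ⟨n, f, ⟨-, hb, -⟩, h0, hn⟩ := ih
    refine ⟨n + 1, fun i => if i ≤ n then f i else u, ⟨le_rfl, fun i hi => ?_, by omega⟩,
      by simpa using h0, by simp⟩
    rcases Nat.lt_succ_iff_lt_or_eq.mp hi with hi | rfl
    · have hi' : i + 1 ≤ n := hi
      simpa [hi', hi.le] using hb i hi
    · simpa [hn] using huv

theorem exists_isTrek {E : V → V → Prop} {t a b : V} (ha : Relation.ReflTransGen E t a)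
    (hb : Relation.ReflTransGen E t b) :
    ∃ n k f, IsTrek E n k f ∧ f 0 = a ∧ f n = b := by
  induction hb with
  | refl =>
    obtain ⟨n, f, h⟩ := exists_isTrek_backward ha
    exact ⟨n, n, f, h⟩
  | @tail u v _ huv ih =>
    obtain ⟨n, k, f, ⟨hk, hb, hf⟩, h0, hn⟩ := ih
    refine ⟨n + 1, k, fun i => if i ≤ n then f i else v, ⟨by omega, fun i hi => ?_,
      fun i hki hi => ?_⟩, by simpa using h0, by simp⟩
    · have h1 : i + 1 ≤ n := by omega
      have h2 : i ≤ n := by omega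
      simpa [h1, h2] using hb i hi
    · rcases Nat.lt_succ_iff_lt_or_eq.mp hi with hi | rfl
      · have hi' : i + 1 ≤ n := hi
        simpa [hi', hi.le] using hf i hki hi
      · simpa [hn] using huv

/-- Cutting the closed piece between two occurrences of a vertex out of a trek leaves a trek. -/
theorem IsTrek.splice {E : V → V → Prop} {n k : ℕ} {f : ℕ → V} (h : IsTrek E n k f) {a b : ℕ}
    (hab : a < b) (hbn : b ≤ n) (hf : f a = f b) :
    IsTrek E (n - (b - a)) (min k a + (k - b))
      (fun i => if i ≤ a then f i else f (i + (b - a))) := by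
  obtain ⟨hk, hb, hfw⟩ := h
  refine ⟨by omega, fun i hi => ?_, fun i hki hi => ?_⟩
  · rcases lt_trichotomy i a with hia | rfl | hia
    · have h1 : i + 1 ≤ a := hia
      simpa [h1, hia.le] using hb i (by omega)
    · have h1 : i + 1 + (b - i) = b + 1 := by omega
      simpa [h1, hf] using hb b (by omega)
    · have h1 : ¬ i + 1 ≤ a := by omega
      have h2 : i + 1 + (b - a) = i + (b - a) + 1 := by omega
      simpa [h1, h2, hia.not_ge] using hb (i + (b - a)) (by omega)
  · rcases lt_trichotomy i a with hia | rfl | hia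
    · have h1 : i + 1 ≤ a := hia
      simpa [h1, hia.le] using hfw i (by omega) (by omega)
    · have h1 : i + 1 + (b - i) = b + 1 := by omega
      simpa [h1, hf] using hfw b (by omega) (by omega)
    · have h1 : ¬ i + 1 ≤ a := by omega
      have h2 : i + 1 + (b - a) = i + (b - a) + 1 := by omega
      simpa [h1, h2, hia.not_ge] using hfw (i + (b - a)) (by omega) (by omega)

theorem exists_isTrek_injOn {E : V → V → Prop} {t a b : V} (ha : Relation.ReflTransGen E t a)
    (hb : Relation.ReflTransGen E t b) :
    ∃ n k f, IsTrek E n k f ∧ f 0 = a ∧ f n = b ∧ Set.InjOn f (Set.Iic n) := by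
  classical
  have hex := exists_isTrek ha hb
  obtain ⟨k, f, hT, h0, hn⟩ := Nat.find_spec hex
  have hlt : ∀ i j, i < j → j ≤ Nat.find hex → f i ≠ f j := by
    intro i j hij hj hfij
    refine Nat.find_min hex (m := Nat.find hex - (j - i)) (by omega)
      ⟨_, _, hT.splice hij hj hfij, by simpa using h0, ?_⟩
    split_ifs with h
    · have h1 : j = Nat.find hex := by omega
      have h2 : Nat.find hex - (j - i) = i := by omega
      rw [h2, hfij, h1, hn]
    · rw [Nat.sub_add_cancel (by omega), hn]
  refine ⟨_, k, f, hT, h0, hn, fun i hi j hj hij => ?_⟩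
  rcases lt_trichotomy i j with h | h | h
  · exact absurd hij (hlt i j h hj)
  · exact h
  · exact absurd hij.symm (hlt j i h hi)

/-- A d-separation in `G.underline S` rules out collider-free connections none of whose edges
points out of a vertex of `S` or of the conditioning set. -/
theorem dSep.not_common_ancestor {G : CausalGraph V} {S A B X : Set V}
    (h : (G.underline S).dSep A B X) {t a b : V} (ha : a ∈ A) (hb : b ∈ B)
    (hta : (G.underline (S ∪ X)).Desc t a) (htb : (G.underline (S ∪ X)).Desc t b) : False := by
  obtain ⟨n, k, f, ⟨-, hbw, hfw⟩, h0, hn, hinj⟩ := exists_isTrek_injOn hta htb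
  refine h ⟨⟨n, fun i => f i, fun i => decide (k ≤ (i : ℕ)), fun i => ?_⟩,
    fun i j hij => Fin.ext (hinj (Nat.lt_succ_iff.mp i.2) (Nat.lt_succ_iff.mp j.2) hij),
    by simpa [Walk.first, h0] using ha, by simpa [Walk.last, hn] using hb, ?_, ?_⟩
  · by_cases hi : k ≤ (i : ℕ)
    · obtain ⟨he, hS⟩ := hfw i hi i.2
      simpa [hi] using show (G.underline S).Edge _ _ from ⟨he, fun hs => hS (Or.inl hs)⟩
    · obtain ⟨he, hS⟩ := hbw i (by omega)
      simpa [hi] using show (G.underline S).Edge _ _ from ⟨he, fun hs => hS (Or.inl hs)⟩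
  · rintro j ⟨hj0, hjn, h1, h2⟩
    simp only [decide_eq_true_eq, decide_eq_false_iff_not] at h1 h2
    omega
  · rintro j ⟨hj0, hjn, hj⟩ hX
    simp only [decide_eq_true_eq, decide_eq_false_iff_not] at hj hjn
    rcases hj with hj | hj
    · have := (hbw (j - 1) (by omega)).2
      rw [Nat.sub_add_cancel hj0] at this
      exact this (Or.inr hX)
    · exact (hfw j hj hjn).2 (Or.inr hX)

theorem Desc.underline_anti {G : CausalGraph V} {S T : Set V} (hST : S ⊆ T) {u v : V}
    (h : (G.underline T).Desc u v) : (G.underline S).Desc u v :=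
  Relation.ReflTransGen.mono (r := (G.underline T).Edge) (p := (G.underline S).Edge)
    (fun _ _ he => ⟨he.1, fun hs => he.2 (hST hs)⟩) _ _ h

namespace Walk

variable {G : CausalGraph V} (w : G.Walk)

theorem edge_of_dir_true {i : ℕ} (hi : i < w.len) (h : w.dir ⟨i, hi⟩ = true) :
    G.Edge (w.vert ⟨i, by omega⟩) (w.vert ⟨i + 1, by omega⟩) := by
  simpa [h] using w.valid ⟨i, hi⟩

theorem edge_of_dir_false {i : ℕ} (hi : i < w.len) (h : w.dir ⟨i, hi⟩ = false) :
    G.Edge (w.vert ⟨i + 1, by omega⟩) (w.vert ⟨i, by omega⟩) := by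
  simpa [h] using w.valid ⟨i, hi⟩

variable {w}

/-- A collider-free segment starting with a forward edge is directed. -/
theorem desc_of_dir_true {S : Set V} {p : ℕ} (hp : p < w.len) (hd : w.dir ⟨p, hp⟩ = true)
    (hout : ∀ i : Fin w.len, p ≤ i → ∀ z ∈ S, ¬ w.OutEdgeAt i z)
    (hcol : ∀ j : Fin (w.len + 1), p < (j : ℕ) → ¬ w.ColliderAt j)
    (q : ℕ) (hpq : p ≤ q) (hq : q < w.len) :
    w.dir ⟨q, hq⟩ = true ∧
      (G.underline S).Desc (w.vert ⟨p, by omega⟩) (w.vert ⟨q + 1, by omega⟩) := by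
  induction q, hpq using Nat.le_induction with
  | base =>
    exact ⟨hd, .single ⟨w.edge_of_dir_true hq hd, fun hs => hout _ le_rfl _ hs (Or.inl ⟨hd, rfl⟩)⟩⟩
  | succ q hpq ih =>
    obtain ⟨h1, h2⟩ := ih (by omega)
    have hd' : w.dir ⟨q + 1, hq⟩ = true := by
      by_contra hne
      exact hcol ⟨q + 1, by omega⟩ (Nat.lt_succ_of_le hpq)
        ⟨Nat.succ_pos q, hq, h1, by simpa using hne⟩
    exact ⟨hd', h2.tail ⟨w.edge_of_dir_true hq hd',
      fun hs => hout ⟨q + 1, hq⟩ (by simp only; omega) _ hs (Or.inl ⟨hd', rfl⟩)⟩⟩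

/-- The ends of a collider-free segment have a common ancestor. -/
theorem exists_common_ancestor {S : Set V} {p : ℕ} (q : ℕ) (hpq : p ≤ q) (hq : q ≤ w.len)
    (hout : ∀ i : Fin w.len, p ≤ i → ∀ z ∈ S, ¬ w.OutEdgeAt i z)
    (hcol : ∀ j : Fin (w.len + 1), p < (j : ℕ) → (j : ℕ) < q → ¬ w.ColliderAt j) :
    ∃ t, (G.underline S).Desc t (w.vert ⟨p, by omega⟩) ∧
      (G.underline S).Desc t (w.vert ⟨q, by omega⟩) := by
  suffices H : (G.underline S).Desc (w.vert ⟨q, by omega⟩) (w.vert ⟨p, by omega⟩) ∨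
      ∃ _ : p < q, w.dir ⟨q - 1, by omega⟩ = true ∧
        ∃ t, (G.underline S).Desc t (w.vert ⟨p, by omega⟩) ∧
          (G.underline S).Desc t (w.vert ⟨q, by omega⟩) by
    rcases H with H | ⟨_, _, H⟩
    · exact ⟨_, H, .refl⟩
    · exact H
  induction q, hpq using Nat.le_induction with
  | base => exact Or.inl .refl
  | succ q hpq ih =>
    have ih := ih (by omega) fun j h1 h2 => hcol j h1 (by omega)
    have hq' : q < w.len := hq
    cases hd : w.dir ⟨q, hq'⟩ with
    | true =>
      have he : (G.underline S).Edge (w.vert ⟨q, by omega⟩) (w.vert ⟨q + 1, by omega⟩) :=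
        ⟨w.edge_of_dir_true hq' hd, fun hs => hout ⟨q, hq'⟩ hpq _ hs (Or.inl ⟨hd, rfl⟩)⟩
      refine Or.inr ⟨by omega, hd, ?_⟩
      rcases ih with ih | ⟨_, _, t, h1, h2⟩
      · exact ⟨_, ih, .single he⟩
      · exact ⟨t, h1, h2.tail he⟩
    | false =>
      have he : (G.underline S).Edge (w.vert ⟨q + 1, by omega⟩) (w.vert ⟨q, by omega⟩) :=
        ⟨w.edge_of_dir_false hq' hd, fun hs => hout ⟨q, hq'⟩ hpq _ hs (Or.inr ⟨hd, rfl⟩)⟩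
      rcases ih with ih | ⟨hlt, h1, _⟩
      · exact Or.inl (ih.head he)
      · exact absurd ⟨by simp only; omega, hq', h1, hd⟩
          (hcol ⟨q, by omega⟩ hlt (Nat.lt_succ_self q))

/-- A walk starting in `S` has a last visit to `S`. -/
theorem exists_last_visit {S : Set V} (h : w.first ∈ S) :
    ∃ p : Fin (w.len + 1), w.vert p ∈ S ∧ ∀ j, p < j → w.vert j ∉ S := by
  classical
  obtain ⟨p, hp⟩ := (Set.toFinite {j | w.vert j ∈ S}).exists_maximal ⟨0, h⟩
  exact ⟨p, hp.1, fun j hj hS => (hp.2 hS hj.le).not_gt hj⟩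

theorem not_outEdgeAt_of_notMem {S : Set V} {i : Fin w.len} {z : V} (hz : z ∈ S)
    (h1 : w.vert i.castSucc ∉ S) (h2 : w.vert i.succ ∉ S) : ¬ w.OutEdgeAt i z := by
  rintro (⟨-, rfl⟩ | ⟨-, rfl⟩) <;> contradiction

theorem not_outEdgeAt_of_forall_notMem {X : Set V} (hX : ∀ j, w.vert j ∉ X) (i : Fin w.len)
    {z : V} (hz : z ∈ X) : ¬ w.OutEdgeAt i z :=
  not_outEdgeAt_of_notMem hz (hX _) (hX _)

end Walk

/-- If edges of a walk from `Z` to `Y` point out of no vertex of `Z` except possibly `U`, and all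
its colliders lie in `Z`, then separation of `Z` from `Y` forces the walk to end with a directed
segment that starts at `U`. -/
theorem desc_of_walk {G : CausalGraph V} {X Y Z : Set V} (hYZ : Disjoint Y Z)
    (hsep : (G.underline Z).dSep Z Y X) {U : V} (w : G.Walk) (hfirst : w.first ∈ Z)
    (hlast : w.last ∈ Y) (hout : ∀ i : Fin w.len, ∀ z ∈ Z \ {U}, ¬ w.OutEdgeAt i z)
    (hX : ∀ j, w.vert j ∉ X) (hcol : ∀ j, w.ColliderAt j → w.vert j ∈ Z) :
    ∃ y ∈ Y, (G.underline (Z \ {U} ∪ X)).Desc U y := by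
  obtain ⟨⟨p, hp⟩, hpZ, hpmax⟩ := Walk.exists_last_visit hfirst
  have hplen : p < w.len := by
    refine lt_of_le_of_ne (Nat.lt_succ_iff.mp hp) fun h => ?_
    subst h
    exact hYZ.notMem_of_mem_left hlast hpZ
  have hnocol : ∀ j : Fin (w.len + 1), p < (j : ℕ) → ¬ w.ColliderAt j :=
    fun j hj hc => hpmax j hj (hcol j hc)
  cases hd : w.dir ⟨p, hplen⟩ with
  | false =>
    obtain ⟨t, h1, h2⟩ := Walk.exists_common_ancestor (S := Z ∪ X) w.len hplen.le le_rfl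
      (fun i hi z hz => by
        rcases hz with hz | hz
        · rcases hi.eq_or_lt with rfl | hi
          · rintro (⟨h, -⟩ | ⟨-, rfl⟩)
            · exact Bool.false_ne_true (hd.symm.trans h)
            · exact hpmax _ (Fin.lt_def.mpr (Nat.lt_succ_self _)) hz
          · exact Walk.not_outEdgeAt_of_notMem hz (hpmax _ (Fin.lt_def.mpr hi))
              (hpmax _ (Fin.lt_def.mpr (Nat.lt_succ_of_lt hi)))
        · exact Walk.not_outEdgeAt_of_forall_notMem hX i hz)
      (fun j hj _ => hnocol j hj)
    exact (hsep.not_common_ancestor hpZ hlast h1 h2).elim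
  | true =>
    have hU : w.vert ⟨p, hp⟩ = U := by
      by_contra hne
      exact hout ⟨p, hplen⟩ _ ⟨hpZ, hne⟩ (Or.inl ⟨hd, rfl⟩)
    have h := (Walk.desc_of_dir_true (S := Z \ {U} ∪ X) hplen hd
      (fun i _ z hz => hz.elim (hout i z) (Walk.not_outEdgeAt_of_forall_notMem hX i))
      hnocol (w.len - 1) (by omega) (by omega)).2
    rw [hU] at h
    have hend : (⟨w.len - 1 + 1, by omega⟩ : Fin (w.len + 1)) = Fin.last w.len :=
      Fin.ext (Nat.sub_add_cancel (by omega))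
    rw [hend] at h
    exact ⟨_, hlast, h⟩

end CausalGraph

/-- If an FD set `Z` (with `I ⊆ Z ⊆ R`) decomposes as
`Z = I ∪ Z_XY ∪ Z_ZY` satisfying conditions (1) and (2), then `Z` is
`I`-inclusion minimal. -/
theorem minimal_of_decomposition
    {V : Type} [Fintype V] (G : CausalGraph V) (hG : G.Acyclic)
    (X Y I R Z : Set V) (hXY : Disjoint X Y) (hIR : I ⊆ R) (hR : Disjoint R (X ∪ Y))
    (hIZ : I ⊆ Z) (hZR : Z ⊆ R) (hZ : G.IsFDSet X Y Z)
    (Zxy Zzy : Set V)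
    (hdecomp : Z = I ∪ Zxy ∪ Zzy)
    (h1 : ∀ W ∈ Zxy,
      ∃ w : G.Walk, w.IsPath ∧ w.IsDirected ∧ w.first ∈ X ∧ w.last ∈ Y ∧
        (∃ j, w.vert j = W) ∧ (∀ j, w.vert j ∈ X → (j : ℕ) = 0) ∧
        (∀ j, w.vert j ∈ Z → w.vert j = W))
    (h2 : ∀ W ∈ Zzy,
      ∃ w : G.Walk, w.IsWay ∧ w.IsBD ∧ w.first ∈ I ∪ Zxy ∧ w.last ∈ Y ∧
        (∀ j, w.vert j ∈ I ∪ Zxy → (j : ℕ) = 0) ∧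
        (∃ i : Fin w.len, w.dir i = true ∧ w.vert i.castSucc = W) ∧
        (∀ i : Fin w.len, ∀ z ∈ Z \ {W}, ¬ w.OutEdgeAt i z) ∧
        (∀ j, w.vert j ∉ X) ∧
        (∀ j, w.ColliderAt j → w.vert j ∈ Z)) :
    G.IsMinFDSet X Y I R Z := by
  refine ⟨hIZ, hZR, hZ, fun Z' hZ' hIZ' hFD => ?_⟩
  obtain ⟨-, -, hYZ, -, -, hsep⟩ := hZ
  obtain ⟨-, -, hYZ', hint, -, hsep'⟩ := hFD
  have hxyZ' : Zxy ⊆ Z' := by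
    intro W hW
    obtain ⟨w, hpath, hdir, hfirst, hlast, -, -, honly⟩ := h1 W hW
    obtain ⟨j, hj⟩ := hint w hpath hdir hfirst hlast
    exact honly j (hZ'.1 hj) ▸ hj
  have hzy : ∀ U ∈ Z, U ∉ Z' → U ∈ Zzy := by
    intro U hU hU'
    rw [hdecomp] at hU
    rcases hU with (hU | hU) | hU
    · exact absurd (hIZ' hU) hU'
    · exact absurd (hxyZ' hU) hU'
    · exact hU
  have hbaseZ' : I ∪ Zxy ⊆ Z' := Set.union_subset hIZ' hxyZ'
  have hdesc : ∀ U ∈ Z, U ∉ Z' → ∃ y ∈ Y, (G.underline (Z' ∪ X)).Desc U y := by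
    intro U hU hU'
    obtain ⟨w, -, -, hfirst, hlast, -, -, hout, hX, hcol⟩ := h2 U (hzy U hU hU')
    obtain ⟨y, hy, h⟩ := CausalGraph.desc_of_walk hYZ hsep w (hZ'.1 (hbaseZ' hfirst)) hlast
      hout hX hcol
    have hsub : Z' ⊆ Z \ {U} := fun z hz => ⟨hZ'.1 hz, fun h => hU' (h ▸ hz)⟩
    exact ⟨y, hy, h.underline_anti (Set.union_subset_union_left _ hsub)⟩
  obtain ⟨W, hWZ, hWZ'⟩ := Set.exists_of_ssubset hZ'
  obtain ⟨w, -, -, hfirst, hlast, -, -, hout, hX, hcol⟩ := h2 W (hzy W hWZ hWZ')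
  obtain ⟨⟨p, hp⟩, hpZ', hpmax⟩ := CausalGraph.Walk.exists_last_visit (hbaseZ' hfirst)
  have hout' : ∀ i : Fin w.len, p ≤ i → ∀ z ∈ Z' ∪ X, ¬ w.OutEdgeAt i z := by
    rintro i - z (hz | hz)
    · refine hout i z ⟨hZ'.1 hz, ?_⟩
      rintro rfl
      exact hWZ' hz
    · exact CausalGraph.Walk.not_outEdgeAt_of_forall_notMem hX i hz
  by_cases hex : ∃ q, ∃ hq : q < w.len + 1, p < q ∧ w.ColliderAt ⟨q, hq⟩
  · classical
    obtain ⟨hq, hpq, hc⟩ := Nat.find_spec hex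
    obtain ⟨t, ht1, ht2⟩ := CausalGraph.Walk.exists_common_ancestor (Nat.find hex) hpq.le
      (Nat.lt_succ_iff.mp hq) hout' fun j h1 h2 hj => Nat.find_min hex h2 ⟨j.2, h1, hj⟩
    obtain ⟨y, hy, hqy⟩ := hdesc _ (hcol _ hc) (hpmax _ hpq)
    exact hsep'.not_common_ancestor hpZ' hy ht1 (ht2.trans hqy)
  · obtain ⟨t, ht1, ht2⟩ := CausalGraph.Walk.exists_common_ancestor w.len
      (Nat.lt_succ_iff.mp hp) le_rfl hout' fun j h1 _ hj => hex ⟨j, j.2, h1, hj⟩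
    exact hsep'.not_common_ancestor hpZ' hlast ht1 ht2
end

section
/- Let G be a DAG and X, Y, Z pairwise disjoint sets of vertices such that (Z ⊥ X)_{G_underline(X)} holds (condition FD(2)). Then every proper BD path from a vertex of Z to a vertex of Y that is open given X in G_underline(Z) contains no collider and contains no vertex of X. -/
namespace CausalGraph

variable {V : Type}

namespace Walk

variable {G : CausalGraph V}

/-- The walk of length zero at `a`. -/
def nil (G : CausalGraph V) (a : V) : G.Walk where
  len := 0
  vert := fun _ => a
  dir := Fin.elim0
  valid := fun i => i.elim0

/-- Prepend the vertex `a` to a walk, along an edge traversed in direction `b`. -/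
def cons (w : G.Walk) (a : V) (b : Bool)
    (h : if b then G.Edge a w.first else G.Edge w.first a) : G.Walk where
  len := w.len + 1
  vert := Fin.cons a w.vert
  dir := Fin.cons b w.dir
  valid := by
    intro i
    refine Fin.cases ?_ (fun i => ?_) i
    · simpa [first] using h
    · simpa [← Fin.succ_castSucc] using w.valid i

/-- The part of a walk from position `j` on. -/
def drop (w : G.Walk) (j : Fin (w.len + 1)) : G.Walk where
  len := w.len - j
  vert := fun i => w.vert ⟨j + i, by omega⟩
  dir := fun i => w.dir ⟨j + i, by omega⟩
  valid := fun i => w.valid ⟨j + i, by omega⟩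

lemma first_drop (w : G.Walk) (j : Fin (w.len + 1)) : (w.drop j).first = w.vert j := rfl

lemma last_drop (w : G.Walk) (j : Fin (w.len + 1)) : (w.drop j).last = w.last := by
  simp only [drop, last]
  congr 1
  ext
  simp only [Fin.val_last]
  omega

lemma IsPath.drop {w : G.Walk} (hw : w.IsPath) (j : Fin (w.len + 1)) : (w.drop j).IsPath := by
  intro a b hab
  have := congrArg Fin.val (hw hab)
  ext
  simpa using this

lemma last_cons (w : G.Walk) (a : V) (b : Bool)
    (h : if b then G.Edge a w.first else G.Edge w.first a) : (w.cons a b h).last = w.last := by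
  change Fin.cons (α := fun _ => V) a w.vert (Fin.last w.len).succ = _
  rw [Fin.cons_succ]
  rfl

lemma IsPath.cons {w : G.Walk} (hw : w.IsPath) {a : V} (ha : ∀ j, w.vert j ≠ a) (b : Bool)
    (h : if b then G.Edge a w.first else G.Edge w.first a) : (w.cons a b h).IsPath := by
  refine Fin.cons_injective_iff.2 ⟨?_, hw⟩
  rintro ⟨j, hj⟩
  exact ha j hj

lemma drop_monotone {w : G.Walk} (hw : Monotone w.dir) (j : Fin (w.len + 1)) :
    Monotone (w.drop j).dir := by
  intro a b hab
  exact hw (Nat.add_le_add_left hab _)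

lemma not_colliderAt_of_monotone {w : G.Walk} (hw : Monotone w.dir) (j : Fin (w.len + 1)) :
    ¬ w.ColliderAt j := by
  rintro ⟨_, h2, ht, hf⟩
  have : w.dir ⟨(j : ℕ) - 1, by omega⟩ ≤ w.dir ⟨j, h2⟩ := hw (Nat.sub_le _ _)
  rw [ht, hf] at this
  exact absurd this (by decide)

lemma nonColliderAt_of_not_colliderAt {w : G.Walk} {j : Fin (w.len + 1)} (h0 : 0 < (j : ℕ))
    (h1 : (j : ℕ) < w.len) (h : ¬ w.ColliderAt j) : w.NonColliderAt j := by
  refine ⟨h0, h1, ?_⟩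
  by_contra! hc
  exact h ⟨h0, h1, by simpa using hc.1, by simpa using hc.2⟩

end Walk

lemma exists_directed_path {G : CausalGraph V} {u b : V} (h : G.Desc u b) :
    ∃ w : G.Walk, w.IsPath ∧ w.IsDirected ∧ w.first = u ∧ w.last = b := by
  induction h using Relation.ReflTransGen.head_induction_on with
  | refl =>
    exact ⟨Walk.nil G b, fun i j _ => Subsingleton.elim (α := Fin 1) i j, fun i => i.elim0,
      rfl, rfl⟩
  | @head a c hac _ ih =>
    obtain ⟨w, hp, hd, hf, hl⟩ := ih
    by_cases ha : ∃ j, w.vert j = a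
    · obtain ⟨j, hj⟩ := ha
      exact ⟨w.drop j, hp.drop j, fun i => hd _, hj, (w.last_drop j).trans hl⟩
    · push Not at ha
      refine ⟨w.cons a true (by simpa [hf] using hac), hp.cons ha _ _, fun i => ?_, rfl,
        (w.last_cons _ _ _).trans hl⟩
      exact Fin.cases rfl hd i

/-- Two vertices with a common ancestor are joined by a path without colliders. -/
lemma exists_path_monotone_dir {G : CausalGraph V} {u a b : V} (ha : G.Desc u a)
    (hb : G.Desc u b) :
    ∃ w : G.Walk, w.IsPath ∧ Monotone w.dir ∧ w.first = a ∧ w.last = b := by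
  induction ha with
  | refl =>
    obtain ⟨w, hp, hd, h⟩ := exists_directed_path hb
    exact ⟨w, hp, fun i j _ => by rw [hd i, hd j], h⟩
  | @tail c a _ hca ih =>
    obtain ⟨w, hp, hm, hf, hl⟩ := ih
    by_cases ha : ∃ j, w.vert j = a
    · obtain ⟨j, hj⟩ := ha
      exact ⟨w.drop j, hp.drop j, Walk.drop_monotone hm j, hj, (w.last_drop j).trans hl⟩
    · push Not at ha
      refine ⟨w.cons a false (by simpa [hf] using hca), hp.cons ha _ _, ?_, rfl,
        (w.last_cons _ _ _).trans hl⟩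
      intro i j hij
      change Fin.cons (α := fun _ => Bool) false w.dir i ≤
        Fin.cons (α := fun _ => Bool) false w.dir j
      induction i using Fin.cases with
      | zero => simp
      | succ i =>
        induction j using Fin.cases with
        | zero => exact absurd (Fin.le_def.1 hij) (by simp)
        | succ j => simpa using hm (Fin.succ_le_succ_iff.1 hij)

lemma dSep.no_common_ancestor {G : CausalGraph V} {A B : Set V} (h : G.dSep A B ∅) {u a b : V}
    (ha : a ∈ A) (hb : b ∈ B) (hua : G.Desc u a) : ¬ G.Desc u b := by
  intro hub
  obtain ⟨w, hp, hm, rfl, rfl⟩ := exists_path_monotone_dir hua hub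
  exact h ⟨w, hp, ha, hb, fun j hj => (Walk.not_colliderAt_of_monotone hm j hj).elim,
    fun _ _ => Set.notMem_empty _⟩

/-- A directed path into `X` can be stopped at its first vertex in `X`. -/
lemma exists_desc_underline {G : CausalGraph V} {X Z : Set V} {v d : V} (hd : d ∈ X)
    (h : (G.underline Z).Desc v d) : ∃ x ∈ X, (G.underline X).Desc v x := by
  induction h using Relation.ReflTransGen.head_induction_on with
  | refl => exact ⟨d, hd, .refl⟩
  | @head a c hac _ ih =>
    by_cases ha : a ∈ X
    · exact ⟨a, ha, .refl⟩
    · obtain ⟨x, hx, hcx⟩ := ih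
      exact ⟨x, hx, .head ⟨hac.1, ha⟩ hcx⟩

/-- The initial segment of a walk up to its first collider is a trek avoiding edges out of `X`,
as soon as its vertices before that collider are not in `X`. -/
lemma exists_common_ancestor_of_first_collider {G : CausalGraph V} {X Z : Set V}
    (w : (G.underline Z).Walk) (c : Fin (w.len + 1)) (hc : w.ColliderAt c)
    (hmin : ∀ j < c, ¬ w.ColliderAt j) (hX : ∀ j < c, w.vert j ∉ X) :
    ∃ u, (G.underline X).Desc u w.first ∧ (G.underline X).Desc u (w.vert c) := by
  obtain ⟨_, hcl, hct, _⟩ := hc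
  have key : ∀ (n : ℕ) (hn : n ≤ c),
      (G.underline X).Desc (w.vert ⟨n, by omega⟩) w.first ∨
        (∃ h : 0 < n, w.dir ⟨n - 1, by omega⟩ = true) ∧
          ∃ u, (G.underline X).Desc u w.first ∧
            (G.underline X).Desc u (w.vert ⟨n, by omega⟩) := by
    intro n
    induction n with
    | zero => exact fun _ => .inl .refl
    | succ n ih =>
      intro hn
      have hv := w.valid ⟨n, by omega⟩
      have hnX : w.vert ⟨n, by omega⟩ ∉ X := hX _ (Fin.lt_def.2 (by simpa using hn))
      cases hdir : w.dir ⟨n, by omega⟩ with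
      | true =>
        rw [hdir, if_pos rfl] at hv
        have he : (G.underline X).Edge (w.vert ⟨n, by omega⟩) (w.vert ⟨n + 1, by omega⟩) :=
          ⟨hv.1, hnX⟩
        refine .inr ⟨⟨n.succ_pos, hdir⟩, ?_⟩
        rcases ih (by omega) with h | ⟨_, u, h1, h2⟩
        · exact ⟨_, h, .single he⟩
        · exact ⟨u, h1, h2.tail he⟩
      | false =>
        have hlt : n + 1 < c := by
          refine lt_of_le_of_ne hn fun h => ?_
          have : w.dir ⟨(c : ℕ) - 1, by omega⟩ = w.dir ⟨n, by omega⟩ := by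
            congr 2
            omega
          simp [hct, hdir] at this
        rw [hdir, if_neg (by simp)] at hv
        rcases ih (by omega) with h | ⟨⟨h0, h1⟩, _⟩
        · exact .inl (.head ⟨hv.1, hX _ (Fin.lt_def.2 hlt)⟩ h)
        · exact (hmin ⟨n, by omega⟩ (Fin.lt_def.2 (by simpa using hn))
            ⟨h0, by simp; omega, h1, hdir⟩).elim
  rcases key c le_rfl with h | ⟨_, h⟩
  · exact ⟨_, h, .refl⟩
  · exact h

end CausalGraph

/-- If `X`, `Y`, `Z` are pairwise disjoint and FD(2) holds, then every
proper BD path from `Z` to `Y` open given `X` in `G_underline(Z)` contains no collider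
and no vertex of `X`. -/
theorem proper_bd_open_no_collider
    {V : Type} [Fintype V] (G : CausalGraph V) (hG : G.Acyclic)
    (X Y Z : Set V) (hXY : Disjoint X Y) (hXZ : Disjoint X Z) (hYZ : Disjoint Y Z)
    (hFD2 : (G.underline X).dSep Z X ∅) :
    ∀ w : (G.underline Z).Walk, w.IsPath → w.IsBD → w.first ∈ Z → w.last ∈ Y →
      (∀ j, w.vert j ∈ Z → (j : ℕ) = 0) → w.PathOpen X →
      (∀ j, ¬ w.ColliderAt j) ∧ (∀ j, w.vert j ∉ X) := by
  intro w _ _ hfirst hlast _ hopen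
  have hvX : ∀ j : Fin (w.len + 1), ¬ w.ColliderAt j → w.vert j ∉ X := by
    intro j hj
    rcases Nat.eq_zero_or_pos j with h0 | h0
    · obtain rfl : j = 0 := Fin.ext h0
      exact fun h => Set.disjoint_left.1 hXZ h hfirst
    · rcases Nat.lt_or_ge j w.len with h1 | h1
      · exact hopen.2 j (CausalGraph.Walk.nonColliderAt_of_not_colliderAt h0 h1 hj)
      · obtain rfl : j = Fin.last w.len := Fin.ext (by simp; omega)
        exact fun h => Set.disjoint_left.1 hXY h hlast
  have hcol : ∀ j, ¬ w.ColliderAt j := by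
    intro j
    induction j using WellFoundedLT.induction with
    | ind c hmin =>
      intro hc
      obtain ⟨d, hd, hcd⟩ := hopen.1 c hc
      obtain ⟨x, hx, hcx⟩ := CausalGraph.exists_desc_underline hd hcd
      obtain ⟨u, hu, huc⟩ := CausalGraph.exists_common_ancestor_of_first_collider w c hc hmin
        fun j hj => hvX j (hmin j hj)
      exact hFD2.no_common_ancestor hfirst hx hu (huc.trans hcx)
  exact ⟨hcol, fun j => hvX j (hcol j)⟩
end

section
/- Let G be a DAG, X and Y disjoint sets of vertices, and I ⊆ R ⊆ V with R disjoint from X ∪ Y. Suppose I ⊆ Z_(ii) and every directed path from a vertex of X to a vertex of Y contains a vertex of Z_(ii). Define Z_An := {W ∈ Z_(ii) ∩ An(Y) : W has an edge into a vertex of Y, or there exists a directed path from W to a vertex of Y containing no vertex of X ∪ (Z_(ii) \ {W})} and Z_XY := {W ∈ Z_An ∩ De(X) : there exists a directed path from a vertex of X to W containing no vertex of X other than its first vertex and no vertex of I ∪ (Z_An \ {W})}. Then every directed path from a vertex of X to a vertex of Y contains a vertex of I ∪ Z_XY. -/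
/-- `Z_An`: the vertices `W ∈ Z_(ii) ∩ An(Y)` that have an edge into a vertex of `Y`
or a directed path to a vertex of `Y` containing no vertex of `X ∪ (Z_(ii) \ {W})`. -/
def CausalGraph.ZAn {V : Type} (G : CausalGraph V) (X Y R : Set V) : Set V :=
  {W ∈ G.Zii X Y R ∩ G.ancestors Y |
    (∃ y ∈ Y, G.Edge W y) ∨
    ∃ w : G.Walk, w.IsPath ∧ w.IsDirected ∧ w.first = W ∧ w.last ∈ Y ∧
      ∀ j, w.vert j ∉ X ∪ (G.Zii X Y R \ {W})}

/-- `Z_XY`: the vertices `W ∈ Z_An ∩ De(X)` with a directed path from a vertex of `X`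
to `W` containing no vertex of `X` other than its first vertex and no vertex of
`I ∪ (Z_An \ {W})`. -/
def CausalGraph.ZXY {V : Type} (G : CausalGraph V) (X Y I R : Set V) : Set V :=
  {W ∈ G.ZAn X Y R ∩ G.descendants X |
    ∃ w : G.Walk, w.IsPath ∧ w.IsDirected ∧ w.first ∈ X ∧ w.last = W ∧
      (∀ j, w.vert j ∈ X → (j : ℕ) = 0) ∧
      (∀ j, w.vert j ∉ I ∪ (G.ZAn X Y R \ {W}))}

/-- `Z_ZY`: the vertices `W ∈ Z_An` with a proper BD way from `I ∪ Z_XY` to `W`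
containing no edge pointing out of a vertex of `I ∪ Z_An`, containing no vertex of
`X`, all of whose colliders lie in `I ∪ Z_An`. -/
def CausalGraph.ZZY {V : Type} (G : CausalGraph V) (X Y I R : Set V) : Set V :=
  {W ∈ G.ZAn X Y R |
    ∃ w : G.Walk, w.IsWay ∧ w.IsBD ∧ w.first ∈ I ∪ G.ZXY X Y I R ∧ w.last = W ∧
      (∀ j, w.vert j ∈ I ∪ G.ZXY X Y I R → (j : ℕ) = 0) ∧
      (∀ i : Fin w.len, ∀ z ∈ I ∪ G.ZAn X Y R, ¬ w.OutEdgeAt i z) ∧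
      (∀ j, w.vert j ∉ X) ∧
      (∀ j, w.ColliderAt j → w.vert j ∈ I ∪ G.ZAn X Y R)}

namespace CausalGraph.Walk

variable {V : Type} {G : CausalGraph V}

/-- The segment of a walk between the positions `a ≤ b`. -/
def segment (w : G.Walk) (a b : Fin (w.len + 1)) (hab : a ≤ b) : G.Walk where
  len := (b : ℕ) - a
  vert i := w.vert ⟨(a : ℕ) + i, by have : (a : ℕ) ≤ b := hab; omega⟩
  dir i := w.dir ⟨(a : ℕ) + i, by omega⟩
  valid i := w.valid ⟨(a : ℕ) + i, by omega⟩

theorem segment_first (w : G.Walk) (a b : Fin (w.len + 1)) (hab : a ≤ b) :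
    (w.segment a b hab).first = w.vert a := rfl

theorem segment_last (w : G.Walk) (a b : Fin (w.len + 1)) (hab : a ≤ b) :
    (w.segment a b hab).last = w.vert b :=
  congrArg w.vert (Fin.ext (Nat.add_sub_cancel' (Fin.le_def.1 hab)))

/-- Every position of a segment is a position of the walk between the two ends. -/
theorem segment_vert (w : G.Walk) (a b : Fin (w.len + 1)) (hab : a ≤ b)
    (j : Fin ((w.segment a b hab).len + 1)) :
    ∃ k : Fin (w.len + 1), a ≤ k ∧ k ≤ b ∧ (k : ℕ) = a + j ∧
      (w.segment a b hab).vert j = w.vert k := by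
  have hab' : (a : ℕ) ≤ b := hab
  have hj : (j : ℕ) < (b : ℕ) - a + 1 := j.2
  refine ⟨⟨(a : ℕ) + j, by omega⟩, ?_, ?_, rfl, rfl⟩ <;> rw [Fin.le_def] <;> dsimp only <;> omega

theorem IsPath.segment {w : G.Walk} (hw : w.IsPath) (a b : Fin (w.len + 1)) (hab : a ≤ b) :
    (w.segment a b hab).IsPath := by
  intro i j hij
  have h := congrArg Fin.val (hw hij)
  exact Fin.ext (Nat.add_left_cancel h)

theorem IsDirected.segment {w : G.Walk} (hw : w.IsDirected) (a b : Fin (w.len + 1))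
    (hab : a ≤ b) : (w.segment a b hab).IsDirected :=
  fun _ => hw _

theorem IsDirected.desc {w : G.Walk} (hw : w.IsDirected) : G.Desc w.first w.last := by
  have key : ∀ j : Fin (w.len + 1), G.Desc w.first (w.vert j) := by
    intro j
    induction j using Fin.induction with
    | zero => exact Relation.ReflTransGen.refl
    | succ i ih =>
      have h := w.valid i
      rw [hw i, if_pos rfl] at h
      exact Relation.ReflTransGen.tail ih h
  exact key _

/-- A directed path from `X` to `Y` can be shortened so that it meets `X` only at its start. -/
theorem IsPath.exists_proper_segment {w : G.Walk} (hw : w.IsPath) (hd : w.IsDirected)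
    {X : Set V} (hX : w.first ∈ X) :
    ∃ u : G.Walk, u.IsPath ∧ u.IsDirected ∧ u.first ∈ X ∧ u.last = w.last ∧
      (∀ j, u.vert j ∈ X → (j : ℕ) = 0) ∧ ∀ j, ∃ k, u.vert j = w.vert k := by
  obtain ⟨a, ha, hmax⟩ := Set.exists_max_image {j | w.vert j ∈ X} id (Set.toFinite _) ⟨0, hX⟩
  refine ⟨w.segment a (Fin.last _) (Fin.le_last a), hw.segment .., hd.segment _ _ _, ha,
    segment_last .., fun j hj => ?_, fun j => ?_⟩
  · obtain ⟨k, -, -, hk, hv⟩ := w.segment_vert a (Fin.last _) (Fin.le_last a) j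
    have h : (k : ℕ) ≤ a := hmax k (by rwa [hv] at hj)
    omega
  · obtain ⟨k, -, -, -, hv⟩ := w.segment_vert a (Fin.last _) (Fin.le_last a) j
    exact ⟨k, hv⟩

end CausalGraph.Walk

namespace CausalGraph

variable {V : Type} {G : CausalGraph V}

/-- If `Z_(ii)` meets a directed path to `Y` that avoids `X` after its start,
then so does `Z_An`: the last vertex of the path in `Z_(ii)` belongs to it. -/
theorem exists_mem_ZAn_of_exists_mem_Zii {X Y R : Set V} (hR : Disjoint R X) {w : G.Walk}
    (hw : w.IsPath) (hd : w.IsDirected) (hY : w.last ∈ Y)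
    (hX : ∀ j, w.vert j ∈ X → (j : ℕ) = 0) (hZ : ∃ j, w.vert j ∈ G.Zii X Y R) :
    ∃ j, w.vert j ∈ G.ZAn X Y R := by
  obtain ⟨b, hb, hmax⟩ := Set.exists_max_image {j | w.vert j ∈ G.Zii X Y R} id (Set.toFinite _) hZ
  have hbX : w.vert b ∉ X := Set.disjoint_left.1 hR hb.1.1
  have hs := hd.segment b (Fin.last _) (Fin.le_last b)
  have hdesc := hs.desc
  rw [Walk.segment_first, Walk.segment_last] at hdesc
  refine ⟨b, ⟨hb, _, hY, hdesc⟩, Or.inr ⟨w.segment b (Fin.last _) (Fin.le_last b),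
    hw.segment .., hs, Walk.segment_first .., ?_, fun j => ?_⟩⟩
  · rwa [Walk.segment_last]
  · obtain ⟨k, hbk, -, -, hv⟩ := w.segment_vert b (Fin.last _) (Fin.le_last b) j
    rw [hv]
    rintro (hk | ⟨hk, hne⟩)
    · have hk0 := hX k hk
      have : k = b := le_antisymm (by rw [Fin.le_def]; omega) hbk
      exact hbX (this ▸ hk)
    · exact hne (congrArg w.vert (le_antisymm (hmax k hk) hbk))

/-- On a directed path from `X` that avoids `X` after its start and avoids `I`, the first vertex
in `Z_An` belongs to `Z_XY`. -/
theorem exists_mem_ZXY_of_exists_mem_ZAn {X Y I R : Set V} {w : G.Walk}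
    (hw : w.IsPath) (hd : w.IsDirected) (hfirst : w.first ∈ X)
    (hX : ∀ j, w.vert j ∈ X → (j : ℕ) = 0) (hI : ∀ j, w.vert j ∉ I)
    (hZ : ∃ j, w.vert j ∈ G.ZAn X Y R) :
    ∃ j, w.vert j ∈ G.ZXY X Y I R := by
  obtain ⟨b, hb, hmin⟩ := Set.exists_min_image {j | w.vert j ∈ G.ZAn X Y R} id (Set.toFinite _) hZ
  have hs := hd.segment 0 b (Fin.zero_le b)
  have hdesc := hs.desc
  rw [Walk.segment_first, Walk.segment_last] at hdesc
  refine ⟨b, ⟨hb, _, hfirst, hdesc⟩, w.segment 0 b (Fin.zero_le b), hw.segment .., hs, hfirst,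
    Walk.segment_last .., fun j hj => ?_, fun j => ?_⟩
  · obtain ⟨k, -, -, hk, hv⟩ := w.segment_vert 0 b (Fin.zero_le b) j
    have := hX k (by rwa [hv] at hj)
    omega
  · obtain ⟨k, -, hkb, -, hv⟩ := w.segment_vert 0 b (Fin.zero_le b) j
    rw [hv]
    rintro (hk | ⟨hk, hne⟩)
    · exact hI k hk
    · exact hne (congrArg w.vert (le_antisymm hkb (hmin k hk)))

end CausalGraph

/-- If `I ⊆ Z_(ii)` and `Z_(ii)` intercepts every directed path from `X`
to `Y`, then every directed path from a vertex of `X` to a vertex of `Y` contains a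
vertex of `I ∪ Z_XY`. -/
theorem IZXY_intercepts
    {V : Type} [Fintype V] (G : CausalGraph V) (hG : G.Acyclic)
    (X Y I R : Set V) (hXY : Disjoint X Y) (hIR : I ⊆ R) (hR : Disjoint R (X ∪ Y))
    (hIZ : I ⊆ G.Zii X Y R)
    (hFD1 : G.Intercepts X Y (G.Zii X Y R)) :
    G.Intercepts X Y (I ∪ G.ZXY X Y I R) := by
  intro w hw hd hfirst hlast
  obtain ⟨u, hu, hud, hufirst, hulast, huX, hsub⟩ := hw.exists_proper_segment hd hfirst
  have huY : u.last ∈ Y := hulast ▸ hlast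
  by_cases hI : ∃ j, u.vert j ∈ I
  · obtain ⟨j, hj⟩ := hI
    obtain ⟨k, hk⟩ := hsub j
    exact ⟨k, Or.inl (hk ▸ hj)⟩
  · obtain ⟨j, hj⟩ := CausalGraph.exists_mem_ZXY_of_exists_mem_ZAn hu hud hufirst huX (not_exists.1 hI)
      (CausalGraph.exists_mem_ZAn_of_exists_mem_Zii (hR.mono_right Set.subset_union_left) hu hud huY huX
        (hFD1 u hu hud hufirst huY))
    obtain ⟨k, hk⟩ := hsub j
    exact ⟨k, Or.inr (hk ▸ hj)⟩
end

section
/- There exist a DAG G, two distinct vertices X and Y of G, and constraint sets ∅ = I ⊆ R ⊆ V with R disjoint from {X,Y}, together with two FD sets Z1 and Z2 relative to ({X},{Y}) with I ⊆ Z1, Z2 ⊆ R, such that Z1 is ∅-inclusion minimal and |Z2| < |Z1|. In other words, inclusion-minimal FD sets are not necessarily of minimum cardinality. -/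
namespace CausalGraph

/-- If a predicate is invariant under the edges of `G`, no walk joins a vertex satisfying it to one
that does not, so such vertices are d-separated by every set. -/
theorem dSep_of_edge_invariant {V : Type} {G : CausalGraph V} {A B : Set V} (C : Set V)
    (p : V → Prop) (hp : ∀ u v, G.Edge u v → (p u ↔ p v))
    (hA : ∀ a ∈ A, p a) (hB : ∀ b ∈ B, ¬ p b) : G.dSep A B C := by
  rintro ⟨w, -, hf, hl, -⟩
  refine hB _ hl (Fin.induction (motive := fun j => p (w.vert j)) (hA _ hf) ?_ (Fin.last w.len))
  intro i hi
  have hv := w.valid i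
  split_ifs at hv
  · exact (hp _ _ hv).1 hi
  · exact (hp _ _ hv).2 hi

/-- `Z` intercepts all directed paths from `X` to `Y` if some predicate holds on `X`, fails on `Y`
and is preserved along edges whose head is not in `Z`. -/
theorem intercepts_of_edge_invariant {V : Type} {G : CausalGraph V} {X Y Z : Set V}
    (p : V → Prop) (hp : ∀ u v, G.Edge u v → v ∉ Z → p u → p v)
    (hX : ∀ x ∈ X, p x) (hY : ∀ y ∈ Y, ¬ p y) : G.Intercepts X Y Z := by
  intro w _ hd hf hl
  by_contra! hZ
  refine hY _ hl (Fin.induction (motive := fun j => p (w.vert j)) (hX _ hf) ?_ (Fin.last w.len))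
  intro i hi
  have hv := w.valid i
  rw [if_pos (hd i)] at hv
  exact hp _ _ hv (hZ _) hi

/-- The graph on `{0, …, 4}` with edges `0 → 1`, `0 → 2`, `1 → 3`, `2 → 3` and `3 → 4`. -/
def kite : CausalGraph (Fin 5) :=
  ⟨fun u v => (u, v) ∈ ({(0, 1), (0, 2), (1, 3), (2, 3), (3, 4)} : Finset (Fin 5 × Fin 5))⟩

instance : DecidableRel kite.Edge :=
  fun u v => inferInstanceAs
    (Decidable ((u, v) ∈ ({(0, 1), (0, 2), (1, 3), (2, 3), (3, 4)} : Finset (Fin 5 × Fin 5))))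

theorem kite_acyclic : kite.Acyclic := by
  have hlt : ∀ u v, kite.Edge u v → u < v := by decide
  intro v hv
  have h : ∀ w, Relation.TransGen kite.Edge v w → v < w := by
    intro w hw
    induction hw with
    | single h => exact hlt _ _ h
    | tail _ h ih => exact ih.trans (hlt _ _ h)
  exact (h v hv).false

theorem kite_underline_dSep (Z : Set (Fin 5)) (hZ : 0 ∉ Z) :
    (kite.underline {0}).dSep Z {0} ∅ := by
  have h : ∀ u v, kite.Edge u v → u ≠ 0 → (u ≠ 0 ↔ v ≠ 0) := by decide
  refine dSep_of_edge_invariant _ (· ≠ 0) (fun u v huv => h u v huv.1 huv.2) ?_ (by simp)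
  rintro a ha rfl
  exact hZ ha

theorem kite_isFDSet_pair : kite.IsFDSet {0} {4} {1, 2} := by
  refine ⟨by simp, by simp, by simp, ?_, kite_underline_dSep _ (by simp), ?_⟩
  · have h : ∀ u v, kite.Edge u v → ¬ (v = 1 ∨ v = 2) → u = 0 → v = 0 := by decide
    exact intercepts_of_edge_invariant (· = 0) h (by simp) (by simp)
  · have h : ∀ u v, kite.Edge u v → ¬ (u = 1 ∨ u = 2) → (u < 3 ↔ v < 3) := by decide
    refine dSep_of_edge_invariant _ (· < 3) (fun u v huv => h u v huv.1 huv.2) ?_ ?_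
    · rintro a (rfl | rfl) <;> decide
    · rintro b rfl
      decide

theorem kite_isFDSet_singleton : kite.IsFDSet {0} {4} {3} := by
  refine ⟨by simp, by simp, by simp, ?_, kite_underline_dSep _ (by simp), ?_⟩
  · have h : ∀ u v, kite.Edge u v → ¬ v = 3 → u < 3 → v < 3 := by decide
    refine intercepts_of_edge_invariant (· < 3) h ?_ ?_
    · rintro b rfl
      decide
    · rintro b rfl
      decide
  · have h : ∀ u v, kite.Edge u v → ¬ u = 3 → (u ≠ 4 ↔ v ≠ 4) := by decide
    exact dSep_of_edge_invariant _ (· ≠ 4) (fun u v huv => h u v huv.1 huv.2) (by simp) (by simp)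

/-- A subset of `{1, 2}` intercepting the directed paths of `kite` from `0` to `4` contains both
`1` and `2`, because of the paths `0 → a → 3 → 4`. -/
theorem mem_of_kite_intercepts {Z : Set (Fin 5)} (h : kite.Intercepts {0} {4} Z)
    (hZ : Z ⊆ {1, 2}) (a : Fin 5) (ha : a = 1 ∨ a = 2) : a ∈ Z := by
  let w : kite.Walk :=
    { len := 3
      vert := ![0, a, 3, 4]
      dir := fun _ => true
      valid := by
        rcases ha with rfl | rfl <;> decide }
  have hpath : w.IsPath := by
    rcases ha with rfl | rfl <;> (simp only [Walk.IsPath, w]; decide)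
  obtain ⟨j, hj⟩ := h w hpath (fun _ => rfl) rfl rfl
  change Fin 4 at j
  have hj' := hZ hj
  fin_cases j <;> simp_all [w]

end CausalGraph

/-- There is a DAG with distinct vertices `X`, `Y`, constraint sets
`∅ = I ⊆ R` with `R` disjoint from `{X, Y}`, and FD sets `Z1`, `Z2 ⊆ R` relative to
`({X}, {Y})` such that `Z1` is `∅`-inclusion minimal and `|Z2| < |Z1|`. -/
theorem minimal_not_minimum :
    ∃ (V : Type) (_ : Fintype V) (G : CausalGraph V), G.Acyclic ∧
      ∃ X Y : V, X ≠ Y ∧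
      ∃ R : Set V, Disjoint R {X, Y} ∧
      ∃ Z1 Z2 : Set V, Z1 ⊆ R ∧ Z2 ⊆ R ∧
        G.IsFDSet {X} {Y} Z1 ∧ G.IsFDSet {X} {Y} Z2 ∧
        (∀ Z' : Set V, Z' ⊂ Z1 → ¬ G.IsFDSet {X} {Y} Z') ∧
        Z2.ncard < Z1.ncard := by
  refine ⟨Fin 5, inferInstance, CausalGraph.kite, CausalGraph.kite_acyclic, 0, 4, by decide,
    {1, 2, 3}, by simp, {1, 2}, {3}, by grind, by grind, CausalGraph.kite_isFDSet_pair,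
    CausalGraph.kite_isFDSet_singleton, ?_, ?_⟩
  · intro Z' hZ' hFD
    refine hZ'.2 fun a ha => ?_
    exact CausalGraph.mem_of_kite_intercepts hFD.2.2.2.1 hZ'.1 a ha
  · rw [Set.ncard_singleton, Set.ncard_pair (by decide)]
    decide
end
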